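/- arXiv:1202.4513 — 3 statements merged into one kernel-verified Lean document; each statement's English description precedes it below -/
import Mathlib

section
/- Let E, F, V be finite-dimensional real inner product spaces and β : E × F → V a bilinear map whose image spans V and which factors the inner products: ⟨β(a,v), β(b,w)⟩ = ⟨a,b⟩·⟨v,w⟩ for all a,b ∈ E and v,w ∈ F. Let C_E ⊆ E, C_F ⊆ F, C_V ⊆ V be homogeneous self-dual cones (with respect to the given inner products), let u_E, u_F be interior points of C_E, C_F respectively, and suppose u_V := β(u_E, u_F) lies in the interior of C_V. Suppose moreover that for every linear bijection g : E → E with g(C_E) = C_E there is a linear bijection G : V → V with G(C_V) = C_V and G(β(a,v)) = β(ga, v) for all a, v, and symmetrically for every linear bijection h of F preserving C_F. Let •_E, •_F, •_V be any bilinear, commutative products satisfying the Jordan identity on E, F, V respectively, with units u_E, u_F, u_V and with cones of squares {a •_E a : a ∈ E} = C_E, {v •_F v : v ∈ F} = C_F, {z •_V z : z ∈ V} = C_V (such products exist and are unique by the Koecher–Vinberg theorem). Then for all a, b ∈ E and v, w ∈ F: β(a, u_F) •_V β(b, v) = β(a •_E b, v) and β(u_E, v) •_V β(a, w) = β(a,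 v •_F w). -/
set_option linter.unusedSectionVars false
open scoped RealInnerProductSpace
open Polynomial

/-- Jordan algebra whose cone of squares is self-dual. -/
structure JC {J : Type*} [NormedAddCommGroup J] [InnerProductSpace ℝ J]
    (C : Set J) (m : J →ₗ[ℝ] J →ₗ[ℝ] J) (u : J) : Prop where
  comm : ∀ a b, m a b = m b a
  jordan : ∀ a b, m (m a a) (m a b) = m a (m (m a a) b)
  one : ∀ a, m u a = a
  sq : {z : J | ∃ a : J, m a a = z} = C
  sd : C = {y : J | ∀ x ∈ C, 0 ≤ ⟪x, y⟫}

namespace JC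

section basic
variable {J : Type*} [NormedAddCommGroup J] [InnerProductSpace ℝ J]
  {C : Set J} {m : J →ₗ[ℝ] J →ₗ[ℝ] J} {u : J}

theorem mem_iff (h : JC C m u) {y : J} : y ∈ C ↔ ∀ x ∈ C, 0 ≤ ⟪x, y⟫ := by
  have := Set.ext_iff.1 h.sd y
  simpa using this

theorem sq_mem (h : JC C m u) (x : J) : m x x ∈ C := by
  rw [← h.sq]; exact ⟨x, rfl⟩

theorem ex_sqrt (h : JC C m u) {x : J} (hx : x ∈ C) : ∃ a, m a a = x := by
  rw [← h.sq] at hx; exact hx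

theorem add_mem (h : JC C m u) {x y : J} (hx : x ∈ C) (hy : y ∈ C) : x + y ∈ C := by
  rw [h.mem_iff] at *
  intro c hc
  rw [inner_add_right]
  exact add_nonneg (hx c hc) (hy c hc)

theorem smul_mem (h : JC C m u) {x : J} {r : ℝ} (hr : 0 ≤ r) (hx : x ∈ C) : r • x ∈ C := by
  rw [h.mem_iff] at *
  intro c hc
  rw [inner_smul_right]
  exact mul_nonneg hr (hx c hc)

theorem zero_mem (h : JC C m u) : (0 : J) ∈ C := by
  rw [h.mem_iff]; simp

theorem sum_mem (h : JC C m u) {ι : Type*} (S : Finset ι) (f : ι → J) (hf : ∀ i ∈ S, f i ∈ C) :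
    ∑ i ∈ S, f i ∈ C := by
  classical
  induction S using Finset.induction_on with
  | empty => simpa using h.zero_mem
  | insert a S ha ih =>
    rw [Finset.sum_insert ha]
    exact h.add_mem (hf _ (by simp)) (ih fun i hi => hf i (by simp [hi]))

theorem pointed (h : JC C m u) {x : J} (hx : x ∈ C) (hx' : -x ∈ C) : x = 0 := by
  have := (h.mem_iff.1 hx') x hx
  rw [inner_neg_right] at this
  have h2 := real_inner_self_nonneg (x := x)
  exact inner_self_eq_zero.1 (le_antisymm (by linarith) h2)

theorem closed (h : JC C m u) : IsClosed C := by
  rw [h.sd]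
  have : {y : J | ∀ x ∈ C, 0 ≤ ⟪x, y⟫} = ⋂ x ∈ C, {y : J | 0 ≤ ⟪x, y⟫} := by
    ext; simp
  rw [this]
  refine isClosed_biInter fun x _ => isClosed_le continuous_const ?_
  fun_prop

theorem lim_mem (h : JC C m u) {a b : J} (hab : ∀ e : ℝ, 0 < e → a + e • b ∈ C) : a ∈ C := by
  have ht : Filter.Tendsto (fun e : ℝ => a + e • b) (nhdsWithin 0 (Set.Ioi 0)) (nhds a) := by
    have : Continuous (fun e : ℝ => a + e • b) := by fun_prop
    have := this.tendsto 0
    simp only [zero_smul, add_zero] at this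
    exact this.mono_left nhdsWithin_le_nhds
  refine h.closed.mem_of_tendsto ht ?_
  filter_upwards [self_mem_nhdsWithin] with e he
  exact hab e he

/-- If `e • b + e^2 • c ∈ C` for all `e`, then `b = 0`. -/
theorem quad_zero (h : JC C m u) {b c : J} (hb : ∀ e : ℝ, e • b + (e * e) • c ∈ C) : b = 0 := by
  apply h.pointed
  · apply h.lim_mem (b := c)
    intro e he
    have := h.smul_mem (inv_nonneg.2 he.le) (hb e)
    convert this using 1
    rw [smul_add, smul_smul, smul_smul, ← mul_assoc, inv_mul_cancel₀ he.ne', one_smul, one_mul]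
  · apply h.lim_mem (b := c)
    intro e he
    have := h.smul_mem (inv_nonneg.2 he.le) (hb (-e))
    convert this using 1
    rw [smul_add, smul_smul, smul_smul]
    congr 1
    · rw [mul_neg, inv_mul_cancel₀ he.ne', neg_smul, one_smul]
    · congr 1; field_simp

theorem sq_add (h : JC C m u) (x y : J) : m (x + y) (x + y) = m x x + (2 : ℝ) • m x y + m y y := by
  simp only [map_add, LinearMap.add_apply, h.comm y x]
  module

theorem one' (h : JC C m u) (a : J) : m a u = a := by rw [h.comm, h.one]

theorem u_mem (h : JC C m u) : u ∈ C := by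
  have := h.sq_mem u
  rwa [h.one] at this

theorem sq_zero (h : JC C m u) {x : J} (hx : m x x = 0) : x = 0 := by
  have key : ∀ e : ℝ, u + e • x ∈ C := by
    intro e
    have := h.sq_mem (u + (e / 2) • x)
    rw [h.sq_add] at this
    simp only [map_smul, LinearMap.smul_apply, hx, h.one, smul_zero, add_zero, smul_smul] at this
    convert this using 3
    ring
  apply h.quad_zero (c := u)
  intro e
  by_cases he : e = 0
  · simpa [he] using h.zero_mem
  have := h.smul_mem (mul_self_nonneg e) (key e⁻¹)
  convert this using 1
  rw [smul_add, smul_smul, mul_assoc, mul_inv_cancel₀ he, mul_one, add_comm]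

theorem fr (h : JC C m u) {x y : J} (hxy : m x x + m y y = 0) : x = 0 := by
  apply h.sq_zero
  apply h.pointed (h.sq_mem x)
  rw [neg_eq_of_add_eq_zero_right hxy]
  exact h.sq_mem y

theorem lin (h : JC C m u) (x y z w : J) :
    m (m x y) (m z w) - m z (m (m x y) w) + (m (m y z) (m x w) - m x (m (m y z) w))
    + (m (m z x) (m y w) - m y (m (m z x) w)) = 0 := by
  have h1 := h.jordan (x + y + z) w
  have h2 := h.jordan (x + y) w
  have h3 := h.jordan (y + z) w
  have h4 := h.jordan (x + z) w
  have h5 := h.jordan x w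
  have h6 := h.jordan y w
  have h7 := h.jordan z w
  simp only [map_add, LinearMap.add_apply, h.comm y x, h.comm z y, h.comm z x] at h1 h2 h3 h4 ⊢
  linear_combination (norm := module) (1/2 : ℝ) • h1 - (1/2 : ℝ) • h2 - (1/2 : ℝ) • h3 - (1/2 : ℝ) • h4
    + (1/2 : ℝ) • h5 + (1/2 : ℝ) • h6 + (1/2 : ℝ) • h7

/-- operator form -/
theorem op (h : JC C m u) (x y z : J) :
    m (m (m x z) y) = m (m x z) * m y + m (m y z) * m x + m (m x y) * m z
      - m x * m y * m z - m z * m y * m x := by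
  ext w
  have := h.lin x w z y
  simp only [LinearMap.sub_apply, LinearMap.add_apply, Module.End.mul_apply]
  rw [h.comm w z, h.comm w y, h.comm (m x w) (m z y), h.comm (m z w) (m x y), h.comm (m x w) y,
    h.comm (m z w) y, h.comm w (m (m z x) y), h.comm z x, h.comm z y] at this
  linear_combination (norm := module) -this

theorem pow_comm (h : JC C m u) (a : J) (n : ℕ) : Commute (m ((m a ^ n) u)) (m a) := by
  have hu : m u = 1 := by ext w; simp [h.one]
  have h2 : Commute (m (m a a)) (m a) := by
    change _ * _ = _ * _
    ext w; simpa using h.jordan a w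
  induction n using Nat.strong_induction_on with
  | _ n ih =>
    match n with
    | 0 => simp [hu]
    | 1 => simp [h.one']
    | (k + 2) =>
      have e1 : (m a ^ (k + 2)) u = m (m ((m a ^ k) u) a) a := by
        rw [pow_succ', pow_succ', Module.End.mul_apply, Module.End.mul_apply, h.comm a, h.comm a]
      have e2 : m ((m a ^ k) u) a = (m a ^ (k + 1)) u := by
        rw [pow_succ', Module.End.mul_apply, h.comm a]
      rw [e1, h.op, e2]
      have c0 := ih k (by omega)
      have c1 := ih (k + 1) (by omega)
      have r := Commute.refl (m a)
      exact ((((c1.mul_left r).add_left (h2.mul_left c0)).add_left (c1.mul_left r)).sub_left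
        ((c0.mul_left r).mul_left r)).sub_left ((r.mul_left r).mul_left c0)

theorem poly_comm (h : JC C m u) (a : J) (f : ℝ[X]) :
    Commute (m (aeval (m a) f u)) (m a) := by
  induction f using Polynomial.induction_on' with
  | add p q hp hq =>
    simp only [map_add, LinearMap.add_apply]
    exact hp.add_left hq
  | monomial n r =>
    simp only [aeval_monomial, Module.End.mul_apply, Module.algebraMap_end_apply, map_smul]
    exact (h.pow_comm a n).smul_left r

theorem poly_mul (h : JC C m u) (a : J) (f g : ℝ[X]) :
    m (aeval (m a) f u) (aeval (m a) g u) = aeval (m a) (f * g) u := by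
  have hc : Commute (m (aeval (m a) f u)) (aeval (m a) g) := by
    induction g using Polynomial.induction_on' with
    | add p q hp hq => rw [map_add]; exact hp.add_right hq
    | monomial n r =>
      rw [aeval_monomial]
      exact (Algebra.commute_algebraMap_right _ _).mul_right ((h.poly_comm a f).pow_right n)
  have := LinearMap.congr_fun hc.eq u
  simp only [Module.End.mul_apply] at this
  rw [this, h.one', mul_comm f g, map_mul, Module.End.mul_apply]

end basic

theorem poly_real {μ : ℝ[X]} (h0 : μ ≠ 0) (hfr : ∀ f g : ℝ[X], μ ∣ f * f + g * g → μ ∣ f) :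
    ∃ S : Finset ℝ, ∀ f : ℝ[X], μ ∣ f ↔ ∀ α ∈ S, f.eval α = 0 := by
  classical
  have hrad : IsRadical μ := by
    intro n f hf
    induction n using Nat.strong_induction_on with
    | _ n ih =>
      rcases Nat.lt_or_ge n 2 with hn | hn
      · interval_cases n
        · exact (isUnit_of_dvd_one (by simpa using hf)).dvd
        · simpa using hf
      · apply ih (n - 1) (by omega)
        apply hfr _ 0
        rw [mul_zero, add_zero, ← pow_add]
        exact hf.trans (pow_dvd_pow _ (by omega))
  obtain ⟨q, hq, -, hqr⟩ := exists_prod_multiset_X_sub_C_mul μ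
  have hqu : IsUnit q := by
    by_contra hnu
    have hq0 : q ≠ 0 := by rintro rfl; simp at hq; exact h0 hq.symm
    have hdeg : q.degree ≠ 0 := fun hd => hnu (isUnit_iff_degree_eq_zero.2 hd)
    obtain ⟨z, hz⟩ := IsAlgClosed.exists_aeval_eq_zero ℂ q hdeg
    have him : z.im ≠ 0 := by
      intro him
      have hzr : z = ((z.re : ℝ) : ℂ) := by apply Complex.ext <;> simp [him]
      rw [hzr] at hz
      have : q.eval z.re = 0 := by
        have h3 := aeval_algebraMap_apply ℂ z.re q
        rw [Complex.coe_algebraMap] at h3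
        rw [h3] at hz
        simpa using hz
      have : z.re ∈ q.roots := by rw [mem_roots hq0]; exact this
      simp [hqr] at this
    obtain ⟨k, hk⟩ := quadratic_dvd_of_aeval_eq_zero_im_ne_zero q hz him
    set A := (Multiset.map (fun a => X - C a) μ.roots).prod with hA
    set Q : ℝ[X] := X ^ 2 - C (2 * z.re) * X + C (‖z‖ ^ 2) with hQ
    have hQ' : Q = (X - C z.re) * (X - C z.re) + C z.im * C z.im := by
      rw [hQ, Complex.sq_norm, Complex.normSq_apply]
      simp only [C_mul, C_add]
      have : (C (2:ℝ) : ℝ[X]) = 2 := rfl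
      rw [this]; ring
    have hd : μ ∣ C z.im * (A * k) := by
      apply hfr _ ((X - C z.re) * (A * k))
      refine ⟨A * k, ?_⟩
      rw [← hq, hk, hQ']; ring
    have hd2 : μ ∣ A * k := by
      have := hd.mul_left (C z.im⁻¹)
      rwa [← mul_assoc, ← C_mul, inv_mul_cancel₀ him, C_1, one_mul] at this
    have hne : A * k ≠ 0 := by
      intro h; apply h0; rw [← hq, hk, mul_left_comm, h, mul_zero]
    have hμ : μ = Q * (A * k) := by rw [← hq, hk]; ring
    have hle := natDegree_le_of_dvd hd2 hne
    have hQ0 : Q ≠ 0 := by rintro h; apply h0; rw [hμ, h, zero_mul]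
    rw [hμ, natDegree_mul hQ0 hne] at hle
    have : Q.natDegree = 2 := by
      rw [hQ]; compute_degree!
    omega
  refine ⟨μ.roots.toFinset, fun f => ⟨?_, fun hf => ?_⟩⟩
  · rintro ⟨g, rfl⟩ α hα
    have : μ.eval α = 0 := by simpa [h0] using hα
    rw [eval_mul, this, zero_mul]
  · apply hrad (Multiset.card μ.roots) f
    have h1 : μ ∣ (Multiset.map (fun a => X - C a) μ.roots).prod := by
      obtain ⟨v, rfl⟩ := hqu
      refine ⟨(v⁻¹ : (ℝ[X])ˣ), ?_⟩
      conv_rhs => rw [← hq]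
      rw [mul_assoc, Units.mul_inv, mul_one]
    refine h1.trans ?_
    have : ∀ s : Multiset ℝ, (∀ α ∈ s, f.eval α = 0) →
        (Multiset.map (fun a => X - C a) s).prod ∣ f ^ Multiset.card s := by
      intro s
      induction s using Multiset.induction_on with
      | empty => simp
      | cons a s ih =>
        intro hs
        rw [Multiset.map_cons, Multiset.prod_cons, Multiset.card_cons, pow_succ']
        exact mul_dvd_mul (dvd_iff_isRoot.2 (hs a (by simp)))
          (ih fun α hα => hs α (by simp [hα]))
    exact this _ fun α hα => hf α (by simpa using hα)

section fd
variable {J : Type*} [NormedAddCommGroup J] [InnerProductSpace ℝ J] [FiniteDimensional ℝ J]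
  {C : Set J} {m : J →ₗ[ℝ] J →ₗ[ℝ] J} {u : J}

theorem spectral (h : JC C m u) (a : J) : ∃ (S : Finset ℝ) (q : ℝ → J),
    (∀ α ∈ S, m (q α) (q α) = q α ∧ q α ≠ 0 ∧ m a (q α) = α • q α) ∧ ∑ α ∈ S, q α = u := by
  classical
  let I : Ideal ℝ[X] :=
    { carrier := {f | aeval (m a) f u = 0}
      add_mem' := by
        intro f g hf hg
        simp only [Set.mem_ofPred_eq] at *
        simp [hf, hg]
      zero_mem' := by simp
      smul_mem' := by
        intro f g hg
        simp only [Set.mem_ofPred_eq] at *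
        simp [hg] }
  obtain ⟨μ, hμ⟩ := (IsPrincipalIdealRing.principal I).principal
  have hI : ∀ f : ℝ[X], μ ∣ f ↔ aeval (m a) f u = 0 := by
    intro f
    have : f ∈ I ↔ f ∈ Submodule.span ℝ[X] {μ} := by rw [← hμ]
    rw [show aeval (m a) f u = 0 ↔ f ∈ I from Iff.rfl, this]
    exact (Ideal.mem_span_singleton (α := ℝ[X])).symm
  have h0 : μ ≠ 0 := by
    rintro rfl
    have h1 := (hI (minpoly ℝ (m a))).2 (by simp [minpoly.aeval])
    rw [zero_dvd_iff] at h1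
    exact minpoly.ne_zero (Algebra.IsIntegral.isIntegral (m a)) h1
  obtain ⟨S, hS⟩ := poly_real h0 (by
    intro f g hfg
    rw [hI] at hfg ⊢
    rw [map_add, LinearMap.add_apply, ← h.poly_mul, ← h.poly_mul] at hfg
    exact h.fr hfg)
  have hinj : Set.InjOn (id : ℝ → ℝ) S := fun _ _ _ _ h => h
  have ev : ∀ α ∈ S, ∀ γ ∈ S, (Lagrange.basis S id α).eval γ = if α = γ then 1 else 0 := by
    intro α hα γ hγ
    split_ifs with hh
    · subst hh; exact Lagrange.eval_basis_self hinj hα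
    · exact Lagrange.eval_basis_of_ne (v := id) hh hγ
  refine ⟨S, fun α => aeval (m a) (Lagrange.basis S id α) u, fun α hα => ⟨?_, ?_, ?_⟩, ?_⟩
  · rw [h.poly_mul, ← sub_eq_zero, ← LinearMap.sub_apply, ← map_sub, ← hI, hS]
    intro γ hγ
    simp only [eval_sub, eval_mul, ev α hα γ hγ]
    split_ifs <;> simp
  · intro hh
    rw [← hI, hS] at hh
    have := hh α hα
    simp [ev α hα α hα] at this
  · have : m a (aeval (m a) (Lagrange.basis S id α) u) - α • aeval (m a) (Lagrange.basis S id α) u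
        = aeval (m a) ((X - Polynomial.C α) * Lagrange.basis S id α) u := by
      simp [sub_mul, map_sub]
    rw [← sub_eq_zero, this, ← hI, hS]
    intro γ hγ
    simp only [eval_mul, ev α hα γ hγ, eval_sub, eval_X, eval_C]
    split_ifs with hh <;> simp [hh]
  · rw [← LinearMap.sum_apply, ← map_sum, ← sub_eq_zero]
    have : aeval (m a) (∑ i ∈ S, Lagrange.basis S id i) u - u
      = aeval (m a) (∑ i ∈ S, Lagrange.basis S id i - 1) u := by simp
    rw [this, ← hI, hS]
    intro γ hγ
    rw [eval_sub, eval_finsetSum, Finset.sum_congr rfl fun α hα => ev α hα γ hγ]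
    simp [hγ]

end fd

section peirce
variable {J : Type*} [NormedAddCommGroup J] [InnerProductSpace ℝ J]
  {C : Set J} {m : J →ₗ[ℝ] J →ₗ[ℝ] J} {u : J}

/-- Peirce projection onto the 1-space -/
noncomputable def e1 (L : Module.End ℝ J) : Module.End ℝ J := (2 : ℝ) • (L * L) - L
/-- Peirce projection onto the half-space -/
noncomputable def en (L : Module.End ℝ J) : Module.End ℝ J := (4 : ℝ) • L - (4 : ℝ) • (L * L)
/-- Peirce projection onto the 0-space -/
noncomputable def e0 (L : Module.End ℝ J) : Module.End ℝ J := 1 - (3 : ℝ) • L + (2 : ℝ) • (L * L)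

theorem cubic (h : JC C m u) {p : J} (hp : m p p = p) (x : J) :
    m p (m p (m p x)) = (3 / 2 : ℝ) • m p (m p x) - (1 / 2 : ℝ) • m p x := by
  have := LinearMap.congr_fun (h.op p p p) x
  simp only [hp, LinearMap.sub_apply, LinearMap.add_apply, Module.End.mul_apply] at this
  linear_combination (norm := module) (1 / 2 : ℝ) • this

theorem e1_apply (L : Module.End ℝ J) (x : J) : e1 L x = (2 : ℝ) • L (L x) - L x := rfl
theorem en_apply (L : Module.End ℝ J) (x : J) : en L x = (4 : ℝ) • L x - (4 : ℝ) • L (L x) := rfl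
theorem e0_apply (L : Module.End ℝ J) (x : J) :
    e0 L x = x - (3 : ℝ) • L x + (2 : ℝ) • L (L x) := rfl

theorem L_e1 (h : JC C m u) {p : J} (hp : m p p = p) (x : J) :
    m p (e1 (m p) x) = e1 (m p) x := by
  simp only [e1_apply, map_sub, map_smul, h.cubic hp]
  module
theorem L_en (h : JC C m u) {p : J} (hp : m p p = p) (x : J) :
    m p (en (m p) x) = (1 / 2 : ℝ) • en (m p) x := by
  simp only [en_apply, map_sub, map_smul, h.cubic hp]
  module
theorem L_e0 (h : JC C m u) {p : J} (hp : m p p = p) (x : J) :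
    m p (e0 (m p) x) = 0 := by
  simp only [e0_apply, map_sub, map_add, map_smul, h.cubic hp]
  module
theorem e_sum (L : Module.End ℝ J) (x : J) : e1 L x + en L x + e0 L x = x := by
  simp only [e0_apply, en_apply, e1_apply]; module

/-- the Peirce scaling maps -/
noncomputable def pe (L : Module.End ℝ J) (a b : ℝ) : Module.End ℝ J := a • e1 L + b • en L + e0 L

theorem pe_apply (L : Module.End ℝ J) (a b : ℝ) (x : J) :
    pe L a b x = a • e1 L x + b • en L x + e0 L x := rfl

theorem e_mul (h : JC C m u) {p : J} (hp : m p p = p) (x : J) :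
    (e1 (m p) (e1 (m p) x) = e1 (m p) x ∧ e1 (m p) (en (m p) x) = 0 ∧ e1 (m p) (e0 (m p) x) = 0) ∧
    (en (m p) (e1 (m p) x) = 0 ∧ en (m p) (en (m p) x) = en (m p) x ∧ en (m p) (e0 (m p) x) = 0) ∧
    (e0 (m p) (e1 (m p) x) = 0 ∧ e0 (m p) (en (m p) x) = 0 ∧
      e0 (m p) (e0 (m p) x) = e0 (m p) x) := by
  refine ⟨⟨?_, ?_, ?_⟩, ⟨?_, ?_, ?_⟩, ⟨?_, ?_, ?_⟩⟩
  · rw [e1_apply, h.L_e1 hp, h.L_e1 hp]; module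
  · rw [e1_apply, h.L_en hp, map_smul, h.L_en hp]; module
  · rw [e1_apply, h.L_e0 hp, map_zero]; simp
  · rw [en_apply, h.L_e1 hp, h.L_e1 hp]; module
  · rw [en_apply, h.L_en hp, map_smul, h.L_en hp]; module
  · rw [en_apply, h.L_e0 hp, map_zero]; simp
  · rw [e0_apply, h.L_e1 hp, h.L_e1 hp]; module
  · rw [e0_apply, h.L_en hp, map_smul, h.L_en hp]; module
  · rw [e0_apply, h.L_e0 hp, map_zero]; simp

theorem pe_mul (h : JC C m u) {p : J} (hp : m p p = p) (a b a' b' : ℝ) :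
    pe (m p) a b * pe (m p) a' b' = pe (m p) (a * a') (b * b') := by
  ext x
  obtain ⟨⟨h1, h2, h3⟩, ⟨h4, h5, h6⟩, ⟨h7, h8, h9⟩⟩ := h.e_mul hp x
  simp only [Module.End.mul_apply, pe_apply, map_add, map_smul, h1, h2, h3, h4, h5, h6, h7, h8, h9]
  module

theorem pe_one (L : Module.End ℝ J) : pe L 1 1 = 1 := by
  ext x; rw [pe_apply, one_smul, one_smul, e_sum]; rfl

theorem pe_pow (h : JC C m u) {p : J} (hp : m p p = p) (a b : ℝ) (n : ℕ) :
    pe (m p) a b ^ n = pe (m p) (a ^ n) (b ^ n) := by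
  induction n with
  | zero => simp [pe_one]
  | succ n ih => rw [pow_succ, ih, h.pe_mul hp, pow_succ, pow_succ]

theorem peirce_rule (h : JC C m u) {p : J} (hp : m p p = p) {x y : J} {i j : ℝ}
    (hx : m p x = i • x) (hy : m p y = j • y) :
    en (m p) (m x y) = (4 * (i - j) ^ 2) • m x y := by
  have := h.lin x y p p
  rw [h.comm y p, hx, hy, hp] at this
  simp only [map_smul, LinearMap.smul_apply] at this
  rw [h.comm x p, h.comm y p, h.comm (m x y) p, hx, hy, map_smul, map_smul, h.comm y x] at this
  rw [en_apply]
  linear_combination (norm := module) (4 : ℝ) • this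

theorem one_one (h : JC C m u) {p : J} (hp : m p p = p) {x y : J}
    (hx : m p x = x) (hy : m p y = y) : m p (m x y) = m x y := by
  have := h.lin x p p y
  rw [h.comm x p, hx, hp, hy] at this
  rw [← sub_eq_zero]
  linear_combination (norm := module) -this

/-- The reflection is multiplicative. -/
theorem refl_mul (h : JC C m u) {p : J} (hp : m p p = p) (x y : J) :
    pe (m p) 1 (-1) (m x y) = m (pe (m p) 1 (-1) x) (pe (m p) 1 (-1) y) := by
  have hU : ∀ z, pe (m p) 1 (-1) z = z - (2 : ℝ) • en (m p) z := by
    intro z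
    have := e_sum (m p) z
    rw [pe_apply]
    linear_combination (norm := module) this
  have k1 : ∀ z, m p (e1 (m p) z) = (1 : ℝ) • e1 (m p) z := by
    intro z; rw [one_smul, h.L_e1 hp]
  have k0 : ∀ z, m p (e0 (m p) z) = (0 : ℝ) • e0 (m p) z := by
    intro z; rw [zero_smul, h.L_e0 hp]
  have kn := fun z => h.L_en hp z
  have r11 := h.peirce_rule hp (k1 x) (k1 y)
  have r1n := h.peirce_rule hp (k1 x) (kn y)
  have r10 := h.peirce_rule hp (k1 x) (k0 y)
  have rn1 := h.peirce_rule hp (kn x) (k1 y)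
  have rnn := h.peirce_rule hp (kn x) (kn y)
  have rn0 := h.peirce_rule hp (kn x) (k0 y)
  have r01 := h.peirce_rule hp (k0 x) (k1 y)
  have r0n := h.peirce_rule hp (k0 x) (kn y)
  have r00 := h.peirce_rule hp (k0 x) (k0 y)
  have z10 : m (e1 (m p) x) (e0 (m p) y) = 0 := by
    have e := (h.e_mul hp (m (e1 (m p) x) (e0 (m p) y))).2.1.2.1
    rw [r10, map_smul, r10] at e
    have e2 : (12 : ℝ) • m (e1 (m p) x) (e0 (m p) y) = 0 := by
      linear_combination (norm := module) e
    exact (smul_eq_zero.1 e2).resolve_left (by norm_num)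
  have z01 : m (e0 (m p) x) (e1 (m p) y) = 0 := by
    have e := (h.e_mul hp (m (e0 (m p) x) (e1 (m p) y))).2.1.2.1
    rw [r01, map_smul, r01] at e
    have e2 : (12 : ℝ) • m (e0 (m p) x) (e1 (m p) y) = 0 := by
      linear_combination (norm := module) e
    exact (smul_eq_zero.1 e2).resolve_left (by norm_num)
  have ex := e_sum (m p) x
  have ey := e_sum (m p) y
  have hxy : m x y = m (e1 (m p) x + en (m p) x + e0 (m p) x)
      (e1 (m p) y + en (m p) y + e0 (m p) y) := by rw [ex, ey]
  rw [hU, hxy, pe_apply, pe_apply]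
  simp only [map_add, map_smul, LinearMap.add_apply, LinearMap.smul_apply, r11, r1n, z10, rn1, rnn,
    rn0, z01, r0n, r00, map_zero]
  module

theorem refl_mem (h : JC C m u) {p : J} (hp : m p p = p) {x : J} (hx : x ∈ C) :
    pe (m p) 1 (-1) x ∈ C := by
  obtain ⟨a, rfl⟩ := h.ex_sqrt hx
  rw [h.refl_mul hp]
  exact h.sq_mem _

end peirce

section trace
variable {J : Type*} [NormedAddCommGroup J] [InnerProductSpace ℝ J] [FiniteDimensional ℝ J]
  {C : Set J} {m : J →ₗ[ℝ] J →ₗ[ℝ] J} {u : J}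

/-- trace functional -/
noncomputable def tr (m : J →ₗ[ℝ] J →ₗ[ℝ] J) : J →ₗ[ℝ] ℝ := LinearMap.trace ℝ J ∘ₗ m

theorem tr_assoc (h : JC C m u) (x y z : J) : tr m (m (m x y) z) = tr m (m x (m y z)) := by
  simp only [tr, LinearMap.comp_apply]
  rw [h.op x z y, h.comm x (m y z), h.op y x z, h.comm z y, h.comm x z, h.comm y x]
  simp only [map_add, map_sub]
  have t1 : LinearMap.trace ℝ J (m x * m z * m y) = LinearMap.trace ℝ J (m z * m y * m x) := by
    rw [mul_assoc, LinearMap.trace_mul_comm]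
  have t2 : LinearMap.trace ℝ J (m y * m z * m x) = LinearMap.trace ℝ J (m x * m y * m z) := by
    rw [mul_assoc (m x), LinearMap.trace_mul_comm ℝ (m x)]
  have t3 : LinearMap.trace ℝ J (m y * m x * m z) = LinearMap.trace ℝ J (m z * m y * m x) := by
    rw [mul_assoc (m z), LinearMap.trace_mul_comm ℝ (m z)]
  have t4 : LinearMap.trace ℝ J (m z * m x * m y) = LinearMap.trace ℝ J (m x * m y * m z) := by
    rw [mul_assoc, LinearMap.trace_mul_comm ℝ (m z)]
  rw [t1, t2, t3, t4]
  ring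

theorem tr_idem (h : JC C m u) {p : J} (hp : m p p = p) :
    0 ≤ tr m p ∧ (p ≠ 0 → 0 < tr m p) := by
  have i1 : IsIdempotentElem (e1 (m p)) := by
    change _ * _ = _
    ext x; exact (h.e_mul hp x).1.1
  have i2 : IsIdempotentElem (en (m p)) := by
    change _ * _ = _
    ext x; exact (h.e_mul hp x).2.1.2.1
  have hL : m p = e1 (m p) + (1 / 2 : ℝ) • en (m p) := by
    ext x
    simp only [LinearMap.add_apply, LinearMap.smul_apply, e1_apply, en_apply]
    module
  have ht : tr m p = LinearMap.trace ℝ J (e1 (m p)) + (1 / 2) * LinearMap.trace ℝ J (en (m p)) := by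
    rw [tr, LinearMap.comp_apply]
    conv_lhs => rw [hL]
    simp
  have n1 : 0 ≤ LinearMap.trace ℝ J (e1 (m p)) := by
    rw [(LinearMap.IsIdempotentElem.isProj_range _ i1).trace]; positivity
  have n2 : 0 ≤ LinearMap.trace ℝ J (en (m p)) := by
    rw [(LinearMap.IsIdempotentElem.isProj_range _ i2).trace]; positivity
  refine ⟨by rw [ht]; linarith, fun hne => ?_⟩
  have : LinearMap.trace ℝ J (e1 (m p)) ≠ 0 := by
    intro h0
    rw [LinearMap.IsIdempotentElem.trace_eq_zero_iff i1] at h0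
    have := LinearMap.congr_fun h0 p
    rw [e1_apply, hp, hp, LinearMap.zero_apply] at this
    apply hne
    linear_combination (norm := module) this
  have := lt_of_le_of_ne n1 this.symm
  rw [ht]; linarith

theorem eq_sum {m : J →ₗ[ℝ] J →ₗ[ℝ] J} (h : JC C m u) {a : J} {S : Finset ℝ} {q : ℝ → J}
    (hq : ∀ α ∈ S, m (q α) (q α) = q α ∧ q α ≠ 0 ∧ m a (q α) = α • q α)
    (hs : ∑ α ∈ S, q α = u) : a = ∑ α ∈ S, α • q α := by
  conv_lhs => rw [← h.one' a, ← hs, map_sum]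
  exact Finset.sum_congr rfl fun α hα => (hq α hα).2.2

theorem sq_sum {m : J →ₗ[ℝ] J →ₗ[ℝ] J} (h : JC C m u) {a : J} {S : Finset ℝ} {q : ℝ → J}
    (hq : ∀ α ∈ S, m (q α) (q α) = q α ∧ q α ≠ 0 ∧ m a (q α) = α • q α)
    (hs : ∑ α ∈ S, q α = u) : m a a = ∑ α ∈ S, (α * α) • q α := by
  conv_lhs => arg 2; rw [h.eq_sum hq hs]
  rw [map_sum]
  exact Finset.sum_congr rfl fun α hα => by rw [map_smul, (hq α hα).2.2, smul_smul]

theorem tr_sq (h : JC C m u) (x : J) : 0 ≤ tr m (m x x) := by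
  obtain ⟨S, q, hq, hs⟩ := h.spectral x
  rw [h.sq_sum hq hs, map_sum]
  refine Finset.sum_nonneg fun α hα => ?_
  rw [map_smul]
  exact mul_nonneg (mul_self_nonneg _) (h.tr_idem (hq α hα).1).1

theorem tr_L (h : JC C m u) (p x y : J) : tr m (m x (m p y)) = tr m (m (m p x) y) := by
  rw [h.comm p x, h.tr_assoc]

theorem tr_idem2 (h : JC C m u) {q r : J} (hq : m q q = q) (hr : m r r = r) :
    0 ≤ tr m (m q r) := by
  have k : tr m (m q r) = tr m (m q (m r q)) := by
    conv_lhs => rw [← hq]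
    rw [h.tr_assoc, h.comm q r]
  have sym_e1 : ∀ x y, tr m (m x (e1 (m r) y)) = tr m (m (e1 (m r) x) y) := by
    intro x y
    simp only [e1_apply, map_sub, map_smul, h.tr_L, LinearMap.sub_apply, LinearMap.smul_apply]
  have sym_en : ∀ x y, tr m (m x (en (m r) y)) = tr m (m (en (m r) x) y) := by
    intro x y
    simp only [en_apply, map_sub, map_smul, h.tr_L, LinearMap.sub_apply, LinearMap.smul_apply]
  have k1 : tr m (m q (e1 (m r) q)) = tr m (m (e1 (m r) q) (e1 (m r) q)) := by
    conv_lhs => rw [← (h.e_mul hr q).1.1]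
    rw [sym_e1]
  have k2 : tr m (m q (en (m r) q)) = tr m (m (en (m r) q) (en (m r) q)) := by
    conv_lhs => rw [← (h.e_mul hr q).2.1.2.1]
    rw [sym_en]
  have k3 : m r q = e1 (m r) q + (1 / 2 : ℝ) • en (m r) q := by
    simp only [e1_apply, en_apply]; module
  rw [k, k3, map_add, map_smul, map_add, map_smul, k1, k2, smul_eq_mul]
  have := h.tr_sq (e1 (m r) q)
  have := h.tr_sq (en (m r) q)
  positivity

theorem tr_pos (h : JC C m u) {q c : J} (hq : m q q = q) (hc : c ∈ C) : 0 ≤ tr m (m q c) := by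
  obtain ⟨w, rfl⟩ := h.ex_sqrt hc
  obtain ⟨S, r, hr, hs⟩ := h.spectral w
  rw [h.sq_sum hr hs, map_sum, map_sum]
  refine Finset.sum_nonneg fun α hα => ?_
  rw [map_smul, map_smul]
  exact mul_nonneg (mul_self_nonneg _) (h.tr_idem2 hq (hr α hα).1)

theorem idem_mem (h : JC C m u) {p : J} (hp : m p p = p) : p ∈ C := by
  rw [← hp]; exact h.sq_mem p

theorem compl_idem (h : JC C m u) {p : J} (hp : m p p = p) : m (u - p) (u - p) = u - p := by
  simp only [map_sub, LinearMap.sub_apply, h.one, h.one', hp]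
  abel

theorem resolvent (h : JC C m u) {p : J} (hp : m p p = p) {s : ℝ} (hs : s < 1) {z : J}
    (hz : z - s • m p z ∈ C) : z ∈ C := by
  obtain ⟨S, q, hq, hsum⟩ := h.spectral z
  rw [h.eq_sum hq hsum]
  refine h.sum_mem _ _ fun α hα => ?_
  obtain ⟨hi, hne, hev⟩ := hq α hα
  refine h.smul_mem ?_ (h.idem_mem hi)
  have t := h.tr_pos hi hz
  have e : tr m (m (q α) (m p z)) = α * tr m (m (q α) p) := by
    rw [h.comm p z, ← h.tr_assoc, h.comm (q α) z, hev, map_smul, LinearMap.smul_apply, map_smul,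
      smul_eq_mul]
  rw [map_sub, map_smul, map_sub, map_smul, e, h.comm (q α) z, hev, map_smul] at t
  have t1 := (h.tr_idem hi).2 hne
  have t2 := h.tr_idem2 hi hp
  have t3 := h.tr_idem2 hi (h.compl_idem hp)
  rw [map_sub, h.one', map_sub] at t3
  simp only [smul_eq_mul] at t
  have t4 : 0 < tr m (q α) - s * tr m (m (q α) p) := by
    rcases le_or_gt s 0 with h' | h' <;> nlinarith
  by_contra hneg
  push Not at hneg
  nlinarith [mul_pos_of_neg_of_neg hneg (neg_lt_zero.2 t4)]

theorem res_pe (h : JC C m u) {p : J} (hp : m p p = p) {s : ℝ} (hs : s < 1) {y : J}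
    (hy : y ∈ C) : pe (m p) (1 - s)⁻¹ (1 - s / 2)⁻¹ y ∈ C := by
  apply h.resolvent hp hs
  convert hy using 1
  have hs1 : 1 - s ≠ 0 := by linarith
  have hs2 : 1 - s / 2 ≠ 0 := by linarith
  conv_rhs => rw [← e_sum (m p) y]
  rw [pe_apply]
  simp only [map_add, map_smul, h.L_e1 hp, h.L_en hp, h.L_e0 hp]
  have a1 : (1 - s)⁻¹ - s * (1 - s)⁻¹ = 1 := by field_simp
  have a2 : (1 - s / 2)⁻¹ - s * ((1 - s / 2)⁻¹ * (1 / 2)) = 1 := by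
    have : 2 - s ≠ 0 := by linarith
    field_simp
  linear_combination (norm := module) a1 • (e1 (m p) y) + a2 • (en (m p) y)

theorem pow_mem {T : Module.End ℝ J} (hT : ∀ x ∈ C, T x ∈ C) (n : ℕ) :
    ∀ x ∈ C, (T ^ n) x ∈ C := by
  induction n with
  | zero => intro x hx; simpa using hx
  | succ n ih => intro x hx; rw [pow_succ, Module.End.mul_apply]; exact ih _ (hT x hx)

theorem exp_mem (h : JC C m u) {p : J} (hp : m p p = p) (t : ℝ) {y : J}
    (hy : y ∈ C) : pe (m p) (Real.exp t) (Real.exp (t / 2)) y ∈ C := by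
  have lim : ∀ r : ℝ, Filter.Tendsto (fun n : ℕ => ((1 - r / n)⁻¹) ^ n) Filter.atTop
      (nhds (Real.exp r)) := by
    intro r
    have := (Real.tendsto_one_add_div_pow_exp (-r)).inv₀ (Real.exp_ne_zero _)
    rw [← Real.exp_neg, neg_neg] at this
    refine this.congr fun n => ?_
    rw [inv_pow, neg_div, ← sub_eq_add_neg]
  have L1 := ((lim t).smul_const (e1 (m p) y)).add (((lim (t / 2)).smul_const (en (m p) y)))
  have L2 := L1.add_const (e0 (m p) y)
  rw [pe_apply]
  refine h.closed.mem_of_tendsto L2 ?_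
  obtain ⟨N, hN⟩ := exists_nat_gt t
  filter_upwards [Filter.eventually_gt_atTop (max N 0)] with n hn
  have hn0 : (0 : ℝ) < n := by
    have : 0 < n := lt_of_le_of_lt (le_max_right _ _) hn
    exact_mod_cast this
  have hnN : (N : ℝ) < n := by
    have : N < n := lt_of_le_of_lt (le_max_left _ _) hn
    exact_mod_cast this
  have hlt : t / n < 1 := by rw [div_lt_one hn0]; linarith
  have := pow_mem (C := C) (fun x hx => h.res_pe hp hlt hx) n y hy
  rw [h.pe_pow hp, pe_apply] at this
  convert this using 6
  ring

theorem pe_mem (h : JC C m u) {p : J} (hp : m p p = p) {s : ℝ} (hs : 0 < s) {y : J}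
    (hy : y ∈ C) : pe (m p) (s * s) s y ∈ C := by
  have := h.exp_mem hp (Real.log (s * s)) hy
  rwa [Real.exp_log (mul_pos hs hs), Real.log_mul hs.ne' hs.ne',
    show (Real.log s + Real.log s) / 2 = Real.log s by ring, Real.exp_log hs] at this

end trace

section compress
variable {J : Type*} [NormedAddCommGroup J] [InnerProductSpace ℝ J] [FiniteDimensional ℝ J]
  {C : Set J} {m : J →ₗ[ℝ] J →ₗ[ℝ] J} {u : J}

theorem sub_sq_mem (h : JC C m u) {x : J} (hx : x ∈ C) (hx' : u - x ∈ C) : x - m x x ∈ C := by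
  obtain ⟨S, q, hq, hs⟩ := h.spectral x
  have e : x - m x x = ∑ α ∈ S, (α * (1 - α)) • q α := by
    rw [h.sq_sum hq hs]
    conv_lhs => rw [h.eq_sum hq hs]
    rw [← Finset.sum_sub_distrib]
    exact Finset.sum_congr rfl fun α _ => by module
  rw [e]
  refine h.sum_mem _ _ fun α hα => ?_
  obtain ⟨hi, hne, hev⟩ := hq α hα
  refine h.smul_mem ?_ (h.idem_mem hi)
  have t0 := (h.tr_idem hi).2 hne
  have t1 := h.tr_pos hi hx
  have t2 := h.tr_pos hi hx'
  rw [map_sub, h.one', h.comm, hev, map_sub, map_smul, smul_eq_mul] at t2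
  rw [h.comm, hev, map_smul, smul_eq_mul] at t1
  refine mul_nonneg (nonneg_of_mul_nonneg_left t1 t0) ?_
  apply nonneg_of_mul_nonneg_left (b := tr m (q α)) _ t0
  linarith

theorem comp_aux (h : JC C m u) {Q : Module.End ℝ J} (hQ : ∀ z ∈ C, Q z ∈ C) {π : J}
    (hπ : Q π = 0) (hC : π ∈ C) (hC' : u - π ∈ C) : Q (m π π) = 0 ∧ ∀ x, Q (m π x) = 0 := by
  have hP2 : Q (m π π) = 0 := by
    apply h.pointed (hQ _ (h.sq_mem _))
    have := hQ _ (h.sub_sq_mem hC hC')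
    rwa [map_sub, hπ, zero_sub] at this
  refine ⟨hP2, fun x => ?_⟩
  have key : (2 : ℝ) • Q (m π x) = 0 := by
    apply h.quad_zero (c := Q (m x x))
    intro e
    have := hQ _ (h.sq_mem (π + e • x))
    rw [h.sq_add] at this
    simp only [map_add, map_smul, LinearMap.smul_apply, hP2, zero_add, smul_smul] at this
    convert this using 2
    rw [smul_smul, mul_comm]
  exact (smul_eq_zero.1 key).resolve_left (by norm_num)

theorem compress (h : JC C m u) {P Q : Module.End ℝ J} (hP : ∀ z ∈ C, P z ∈ C)
    (hQ : ∀ z ∈ C, Q z ∈ C) {π π' : J} (hC : π ∈ C) (hC' : π' ∈ C) (hs : π + π' = u)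
    (hPπ : P π = π) (hQπ : Q π = 0) (hPπ' : P π' = 0)
    (k : ∀ z ∈ C, Q z = 0 → P z = z) (z : J) : P z = e1 (m π) z := by
  have s1 : u - π = π' := by rw [← hs]; abel
  have s2 : u - π' = π := by rw [← hs]; abel
  obtain ⟨q1, q2⟩ := h.comp_aux hQ hQπ hC (by rwa [s1])
  obtain ⟨p1, p2⟩ := h.comp_aux hP hPπ' hC' (by rwa [s2])
  have p3 : ∀ x, P (m π x) = P x := by
    intro x
    have := p2 x
    rw [← s1, map_sub, LinearMap.sub_apply, h.one, map_sub, sub_eq_zero] at this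
    exact this.symm
  have hi : m π π = π := by
    rw [← k _ (h.sq_mem π) q1, p3, hPπ]
  have fix_sq : ∀ x, m π x = x → P (m x x) = m x x := by
    intro x hx
    apply k _ (h.sq_mem x)
    rw [← h.one_one hi hx hx, q2]
  have fix : ∀ x, m π x = x → P x = x := by
    intro x hx
    have f1 := fix_sq x hx
    have f2 := fix_sq (π + x) (by rw [map_add, hi, hx])
    rw [h.sq_add, hx, hi] at f2
    simp only [map_add, map_smul, f1, hPπ] at f2
    linear_combination (norm := module) (1 / 2 : ℝ) • f2
  have := fix _ (h.L_e1 hi z)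
  rw [← this, e1_apply, map_sub, map_smul, p3, p3]
  module

end compress

section main
variable {E F V : Type*}
    [NormedAddCommGroup E] [InnerProductSpace ℝ E] [FiniteDimensional ℝ E]
    [NormedAddCommGroup F] [InnerProductSpace ℝ F]
    [NormedAddCommGroup V] [InnerProductSpace ℝ V] [FiniteDimensional ℝ V]

theorem half (β : E →ₗ[ℝ] F →ₗ[ℝ] V)
    (hspan : Submodule.span ℝ {z : V | ∃ a v, β a v = z} = ⊤)
    {CE : Set E} {CV : Set V} {uE : E} {uF : F} {mE : E →ₗ[ℝ] E →ₗ[ℝ] E} {mV : V →ₗ[ℝ] V →ₗ[ℝ] V}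
    (hE : JC CE mE uE) (hV : JC CV mV (β uE uF))
    (hlift : ∀ g : E ≃ₗ[ℝ] E, g '' CE = CE →
      ∃ G : V ≃ₗ[ℝ] V, G '' CV = CV ∧ ∀ (a : E) (v : F), G (β a v) = β (g a) v)
    (a b : E) (v : F) : mV (β a uF) (β b v) = β (mE a b) v := by
  have ext : ∀ S T : Module.End ℝ V, (∀ a v, S (β a v) = T (β a v)) → S = T := by
    intro S T hST
    apply LinearMap.ext_on hspan
    rintro _ ⟨a, v, rfl⟩
    exact hST a v
  -- reduce to idempotents
  suffices H : ∀ p, mE p p = p → mV (β p uF) (β b v) = β (mE p b) v by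
    obtain ⟨S, q, hq, hs⟩ := hE.spectral a
    rw [hE.eq_sum hq hs]
    simp only [map_sum, map_smul, LinearMap.sum_apply, LinearMap.smul_apply]
    exact Finset.sum_congr rfl fun α hα => by rw [H _ (hq α hα).1]
  intro p hp
  have lift : ∀ s : ℝ, (0 < s ∨ s = -1) → ∃ G : Module.End ℝ V, (∀ z ∈ CV, G z ∈ CV) ∧
      ∀ a v, G (β a v) = β (pe (mE p) (s * s) s a) v := by
    intro s hs
    have hs0 : s ≠ 0 := by
      rcases hs with hs | rfl
      · exact hs.ne'
      · norm_num
    have mem : ∀ t : ℝ, (0 < t ∨ t = -1) → ∀ x ∈ CE, pe (mE p) (t * t) t x ∈ CE := by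
      rintro t (ht | rfl) x hx
      · exact hE.pe_mem hp ht hx
      · have := hE.refl_mem hp hx
        rwa [show (-1 : ℝ) * -1 = 1 by norm_num]
    have hsi : 0 < s⁻¹ ∨ s⁻¹ = -1 := by
      rcases hs with hs | rfl
      · left; positivity
      · right; norm_num
    have i1 : pe (mE p) (s * s) s * pe (mE p) (s⁻¹ * s⁻¹) s⁻¹ = 1 := by
      rw [hE.pe_mul hp, mul_inv_cancel₀ hs0, show s * s * (s⁻¹ * s⁻¹) = 1 by field_simp, pe_one]
    have i2 : pe (mE p) (s⁻¹ * s⁻¹) s⁻¹ * pe (mE p) (s * s) s = 1 := by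
      rw [hE.pe_mul hp, inv_mul_cancel₀ hs0, show s⁻¹ * s⁻¹ * (s * s) = 1 by field_simp, pe_one]
    let g : E ≃ₗ[ℝ] E := LinearEquiv.ofLinearMap (pe (mE p) (s * s) s) (pe (mE p) (s⁻¹ * s⁻¹) s⁻¹) i1 i2
    obtain ⟨G, hG, hG'⟩ := hlift g (by
      apply Set.Subset.antisymm
      · rintro _ ⟨x, hx, rfl⟩
        exact mem s hs x hx
      · intro x hx
        exact ⟨_, mem _ hsi x hx, LinearMap.congr_fun i1 x⟩)
    refine ⟨G, fun z hz => ?_, hG'⟩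
    rw [← hG]
    exact ⟨z, hz, rfl⟩
  obtain ⟨U, hUm, hU⟩ := lift (-1) (Or.inr rfl)
  obtain ⟨G2, -, hG2⟩ := lift 2 (Or.inl two_pos)
  let N : Module.End ℝ V := (1 / 2 : ℝ) • (1 - U)
  let P : Module.End ℝ V := (1 / 3 : ℝ) • (G2 - (2 : ℝ) • N - (1 / 2 : ℝ) • (1 + U))
  let R : Module.End ℝ V := 1 - P - N
  have hN : ∀ a v, N (β a v) = β (en (mE p) a) v := by
    intro a v
    have e : N (β a v) = (1 / 2 : ℝ) • (β a v - U (β a v)) := rfl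
    rw [e, hU, pe_apply]
    nth_rewrite 1 [← e_sum (mE p) a]
    simp only [map_add, map_smul, LinearMap.add_apply, LinearMap.smul_apply]
    module
  have hP : ∀ a v, P (β a v) = β (e1 (mE p) a) v := by
    intro a v
    have e : P (β a v) = (1 / 3 : ℝ) • (G2 (β a v) - (2 : ℝ) • N (β a v)
      - (1 / 2 : ℝ) • (β a v + U (β a v))) := rfl
    rw [e, hN, hU, hG2, pe_apply, pe_apply]
    nth_rewrite 5 [← e_sum (mE p) a]
    simp only [map_add, map_smul, LinearMap.add_apply, LinearMap.smul_apply]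
    module
  have hR : ∀ a v, R (β a v) = β (e0 (mE p) a) v := by
    intro a v
    have e : R (β a v) = β a v - P (β a v) - N (β a v) := rfl
    rw [e, hP, hN]
    nth_rewrite 1 [← e_sum (mE p) a]
    simp only [map_add, LinearMap.add_apply]
    module
  have hG : ∀ s : ℝ, (0 < s ∨ s = -1) → ∀ z ∈ CV, (s * s) • P z + s • N z + R z ∈ CV := by
    intro s hs z hz
    obtain ⟨G, hGm, hGβ⟩ := lift s hs
    have : G = (s * s) • P + s • N + R := by
      apply ext
      intro a v
      simp only [LinearMap.add_apply, LinearMap.smul_apply, hP, hN, hR, hGβ, pe_apply, map_add,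
        map_smul]
    have h2 := hGm z hz
    rw [this] at h2
    exact h2
  have hsum : ∀ z, P z + N z + R z = z := by
    intro z
    change P z + N z + (z - P z - N z) = z
    abel
  have NN : ∀ z, N (N z) = N z := by
    intro z
    have : N * N = N := ext _ _ fun a v => by
      rw [Module.End.mul_apply, hN, hN, (hE.e_mul hp a).2.1.2.1]
    exact LinearMap.congr_fun this z
  have PN : ∀ z, P (N z) = 0 := by
    intro z
    have : P * N = 0 := ext _ _ fun a v => by
      rw [Module.End.mul_apply, hN, hP, (hE.e_mul hp a).1.2.1]; simp
    exact LinearMap.congr_fun this z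
  have RN : ∀ z, R (N z) = 0 := by
    intro z
    have : R * N = 0 := ext _ _ fun a v => by
      rw [Module.End.mul_apply, hN, hR, (hE.e_mul hp a).2.2.2.1]; simp
    exact LinearMap.congr_fun this z
  have Npt : ∀ z, N z ∈ CV → N z = 0 := by
    intro z hz
    apply hV.pointed hz
    have := hG (-1) (Or.inr rfl) _ hz
    rw [NN, PN, RN] at this
    simpa using this
  have Ppos : ∀ z ∈ CV, P z ∈ CV := by
    intro z hz
    have lim : Filter.Tendsto (fun e : ℝ => P z + e • N z + (e * e) • R z)
        (nhdsWithin 0 (Set.Ioi 0)) (nhds (P z)) := by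
      have hc : Continuous (fun e : ℝ => P z + e • N z + (e * e) • R z) := by fun_prop
      have := hc.tendsto 0
      simp only [zero_smul, add_zero, mul_zero] at this
      exact this.mono_left nhdsWithin_le_nhds
    refine hV.closed.mem_of_tendsto lim ?_
    filter_upwards [self_mem_nhdsWithin] with e he
    have he : 0 < e := he
    have := hV.smul_mem (mul_self_nonneg e) (hG e⁻¹ (Or.inl (inv_pos.2 he)) z hz)
    convert this using 1
    rw [smul_add, smul_add, smul_smul, smul_smul, show e * e * (e⁻¹ * e⁻¹) = 1 by field_simp,
      show e * e * e⁻¹ = e by field_simp, one_smul]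
  have Rpos : ∀ z ∈ CV, R z ∈ CV := by
    intro z hz
    have lim : Filter.Tendsto (fun e : ℝ => (e * e) • P z + e • N z + R z)
        (nhdsWithin 0 (Set.Ioi 0)) (nhds (R z)) := by
      have hc : Continuous (fun e : ℝ => (e * e) • P z + e • N z + R z) := by fun_prop
      have := hc.tendsto 0
      simp only [zero_smul, zero_add, mul_zero] at this
      exact this.mono_left nhdsWithin_le_nhds
    refine hV.closed.mem_of_tendsto lim ?_
    filter_upwards [self_mem_nhdsWithin] with e he
    exact hG e (Or.inl he) z hz
  have kR : ∀ z ∈ CV, R z = 0 → P z = z := by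
    intro z hz h0
    have : N z ∈ CV := by
      apply hV.lim_mem (b := P z)
      intro e he
      have := hV.smul_mem (inv_nonneg.2 he.le) (hG e (Or.inl he) z hz)
      convert this using 1
      rw [h0, add_zero, smul_add, smul_smul, smul_smul, inv_mul_cancel₀ he.ne',
        show e⁻¹ * (e * e) = e by field_simp, one_smul, add_comm]
    have n0 := Npt z this
    have := hsum z
    rwa [h0, n0, add_zero, add_zero] at this
  have kP : ∀ z ∈ CV, P z = 0 → R z = z := by
    intro z hz h0
    have : N z ∈ CV := by
      apply hV.lim_mem (b := R z)
      intro e he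
      have := hV.smul_mem he.le (hG e⁻¹ (Or.inl (inv_pos.2 he)) z hz)
      convert this using 1
      rw [h0, smul_zero, zero_add, smul_add, smul_smul, mul_inv_cancel₀ he.ne', one_smul]
    have n0 := Npt z this
    have := hsum z
    rwa [h0, n0, add_zero, zero_add] at this
  -- the idempotent in V
  have f1 : e1 (mE p) uE = p := by
    rw [e1_apply, hE.one', hp]; module
  have f0 : e0 (mE p) uE = uE - p := by
    rw [e0_apply, hE.one', hp]; module
  have g1 : P (β uE uF) = β p uF := by rw [hP, f1]
  have g0 : R (β uE uF) = β (uE - p) uF := by rw [hR, f0]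
  have C1 : β p uF ∈ CV := g1 ▸ Ppos _ hV.u_mem
  have C0 : β (uE - p) uF ∈ CV := g0 ▸ Rpos _ hV.u_mem
  have hs : β p uF + β (uE - p) uF = β uE uF := by
    rw [← LinearMap.add_apply, ← map_add]; congr 2; abel
  have a1 : e1 (mE p) p = p := by rw [e1_apply, hp, hp]; module
  have a0 : e0 (mE p) p = 0 := by rw [e0_apply, hp, hp]; module
  have b1 : e1 (mE p) (uE - p) = 0 := by rw [map_sub, f1, a1, sub_self]
  have b0 : e0 (mE p) (uE - p) = uE - p := by rw [map_sub, f0, a0, sub_zero]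
  have r1 := hV.compress Ppos Rpos C1 C0 hs (by rw [hP, a1]) (by rw [hR, a0]; simp)
    (by rw [hP, b1]; simp) kR (β b v)
  have r0 := hV.compress Rpos Ppos C0 C1 (by rw [add_comm, hs]) (by rw [hR, b0])
    (by rw [hP, b1]; simp) (by rw [hR, a0]; simp) kP (β b v)
  have hcomp : ∀ z, mV (β (uE - p) uF) z = z - mV (β p uF) z := by
    intro z
    rw [map_sub, LinearMap.sub_apply, map_sub, LinearMap.sub_apply, hV.one]
  rw [hP, e1_apply] at r1
  rw [hR, e1_apply] at r0
  simp only [hcomp] at r0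
  rw [e1_apply] at r1
  rw [e0_apply] at r0
  simp only [hV.one, map_sub, map_add, map_smul, LinearMap.sub_apply, LinearMap.add_apply,
    LinearMap.smul_apply] at r0 r1
  linear_combination (norm := module) (1 / 2 : ℝ) • r0 - (1 / 2 : ℝ) • r1

end main

end JC

/-- Let `V` be a locally tomographic composite of homogeneous self-dual
cones `(E, C_E, u_E)` and `(F, C_F, u_F)` with a factorizing self-dualizing inner product,
and let `•_E`, `•_F`, `•_V` be the associated Jordan products (commutative products
satisfying the Jordan identity, with the given units and with cones of squares the given
cones).  Then `β(a, u_F) •_V β(b, v) = β(a •_E b, v)` and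
`β(u_E, v) •_V β(a, w) = β(a, v •_F w)`. -/
theorem composite_jordan_product_identities
    {E F V : Type*}
    [NormedAddCommGroup E] [InnerProductSpace ℝ E] [FiniteDimensional ℝ E]
    [NormedAddCommGroup F] [InnerProductSpace ℝ F] [FiniteDimensional ℝ F]
    [NormedAddCommGroup V] [InnerProductSpace ℝ V] [FiniteDimensional ℝ V]
    (β : E →ₗ[ℝ] F →ₗ[ℝ] V)
    (hspan : Submodule.span ℝ {z : V | ∃ a v, β a v = z} = ⊤)
    (hfactor : ∀ (a b : E) (v w : F), ⟪β a v, β b w⟫ = ⟪a, b⟫ * ⟪v, w⟫)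
    (CE : Set E) (CF : Set F) (CV : Set V)
    (hCEsd : CE = {y : E | ∀ x ∈ CE, 0 ≤ ⟪x, y⟫})
    (hCFsd : CF = {y : F | ∀ x ∈ CF, 0 ≤ ⟪x, y⟫})
    (hCVsd : CV = {y : V | ∀ x ∈ CV, 0 ≤ ⟪x, y⟫})
    (hCEhom : ∀ x ∈ interior CE, ∀ y ∈ interior CE,
      ∃ g : E ≃ₗ[ℝ] E, g '' CE = CE ∧ g x = y)
    (hCFhom : ∀ x ∈ interior CF, ∀ y ∈ interior CF,
      ∃ g : F ≃ₗ[ℝ] F, g '' CF = CF ∧ g x = y)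
    (hCVhom : ∀ x ∈ interior CV, ∀ y ∈ interior CV,
      ∃ g : V ≃ₗ[ℝ] V, g '' CV = CV ∧ g x = y)
    (uE : E) (uF : F) (huE : uE ∈ interior CE) (huF : uF ∈ interior CF)
    (huV : β uE uF ∈ interior CV)
    (hliftE : ∀ g : E ≃ₗ[ℝ] E, g '' CE = CE →
      ∃ G : V ≃ₗ[ℝ] V, G '' CV = CV ∧ ∀ (a : E) (v : F), G (β a v) = β (g a) v)
    (hliftF : ∀ h : F ≃ₗ[ℝ] F, h '' CF = CF →
      ∃ H : V ≃ₗ[ℝ] V, H '' CV = CV ∧ ∀ (a : E) (v : F), H (β a v) = β a (h v))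
    (mE : E →ₗ[ℝ] E →ₗ[ℝ] E) (mF : F →ₗ[ℝ] F →ₗ[ℝ] F) (mV : V →ₗ[ℝ] V →ₗ[ℝ] V)
    (hEcomm : ∀ a b : E, mE a b = mE b a)
    (hFcomm : ∀ v w : F, mF v w = mF w v)
    (hVcomm : ∀ z w : V, mV z w = mV w z)
    (hEjordan : ∀ a b : E, mE (mE a a) (mE a b) = mE a (mE (mE a a) b))
    (hFjordan : ∀ v w : F, mF (mF v v) (mF v w) = mF v (mF (mF v v) w))
    (hVjordan : ∀ z w : V, mV (mV z z) (mV z w) = mV z (mV (mV z z) w))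
    (hEone : ∀ a : E, mE uE a = a)
    (hFone : ∀ v : F, mF uF v = v)
    (hVone : ∀ z : V, mV (β uE uF) z = z)
    (hEsq : {z : E | ∃ a : E, mE a a = z} = CE)
    (hFsq : {z : F | ∃ v : F, mF v v = z} = CF)
    (hVsq : {z : V | ∃ w : V, mV w w = z} = CV) :
    ∀ (a b : E) (v w : F),
      mV (β a uF) (β b v) = β (mE a b) v ∧
      mV (β uE v) (β a w) = β a (mF v w) := by
  have hE : JC CE mE uE := ⟨hEcomm, hEjordan, hEone, hEsq, hCEsd⟩
  have hF : JC CF mF uF := ⟨hFcomm, hFjordan, hFone, hFsq, hCFsd⟩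
  have hV : JC CV mV (β uE uF) := ⟨hVcomm, hVjordan, hVone, hVsq, hCVsd⟩
  intro a b v w
  refine ⟨JC.half β hspan hE hV hliftE a b v, ?_⟩
  have hV' : JC CV mV (β.flip uF uE) := hV
  refine JC.half β.flip ?_ hF hV' ?_ v w a
  · rw [← hspan]
    congr 1
    ext z
    exact ⟨fun ⟨v, a, h⟩ => ⟨a, v, h⟩, fun ⟨a, v, h⟩ => ⟨v, a, h⟩⟩
  · intro g hg
    obtain ⟨G, hG, hG'⟩ := hliftF g hg
    exact ⟨G, hG, fun v a => hG' a v⟩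
end

section
/- (Koecher–Vinberg) Let E be a finite-dimensional real inner product space and C ⊆ E a closed convex cone that is pointed (C ∩ (−C) = {0}), self-dual (C = {y ∈ E : ⟨x,y⟩ ≥ 0 for all x ∈ C}), and homogeneous (the group of linear bijections g : E → E with g(C) = C acts transitively on the interior of C). Let u be an interior point of C. Then there exists a unique bilinear map • : E × E → E that is commutative, satisfies the Jordan identity (a•a)•(a•b) = a•((a•a)•b) for all a, b ∈ E, has u as a unit (u • a = a for all a ∈ E), and has cone of squares {a • a : a ∈ E} equal to C; moreover, the resulting Jordan algebra is formally real (a•a + b•b = 0 implies a = b = 0). -/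
open scoped RealInnerProductSpace
set_option linter.unusedSectionVars false

namespace KV
open NormedSpace

section exps
variable {E : Type*} [NormedAddCommGroup E] [InnerProductSpace ℝ E] [FiniteDimensional ℝ E]

lemma exp_add' {X Y : E →L[ℝ] E} (h : Commute X Y) : exp (X + Y) = exp X * exp Y := by
  let _ := NormedAlgebra.restrictScalars ℚ ℝ (E →L[ℝ] E)
  exact exp_add_of_commute h

lemma exp_cont' : Continuous (exp : (E →L[ℝ] E) → (E →L[ℝ] E)) := by
  let _ := NormedAlgebra.restrictScalars ℚ ℝ (E →L[ℝ] E)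
  exact exp_continuous

lemma exp_nsmul' (n : ℕ) (X : E →L[ℝ] E) : exp (n • X) = exp X ^ n := by
  let _ := NormedAlgebra.restrictScalars ℚ ℝ (E →L[ℝ] E)
  exact exp_nsmul n X

lemma exp_mul_neg (X : E →L[ℝ] E) : exp X * exp (-X) = 1 := by
  rw [← exp_add' ((Commute.refl X).neg_right)]; simp

lemma exp_neg_mul (X : E →L[ℝ] E) : exp (-X) * exp X = 1 := by
  rw [← exp_add' ((Commute.refl X).neg_left)]; simp

lemma exp_scalar (c : ℝ) : exp (c • (1 : E →L[ℝ] E)) = Real.exp c • (1 : E →L[ℝ] E) := by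
  have := algebraMap_exp_comm (𝕂 := ℝ) (𝔸 := E →L[ℝ] E) c
  rw [Algebra.algebraMap_eq_smul_one, Algebra.algebraMap_eq_smul_one] at this
  rw [← this, Real.exp_eq_exp_ℝ]

end exps

/-- self-dual cone -/
structure SD {E : Type*} [NormedAddCommGroup E] [InnerProductSpace ℝ E] (C : Set E) : Prop where
  mem : ∀ y, y ∈ C ↔ ∀ x ∈ C, 0 ≤ ⟪x, y⟫

variable {E : Type*} [NormedAddCommGroup E] [InnerProductSpace ℝ E] [FiniteDimensional ℝ E]
variable {C : Set E}

namespace SD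

lemma inn (h : SD C) {x y : E} (hx : x ∈ C) (hy : y ∈ C) : 0 ≤ ⟪x, y⟫ := (h.mem y).1 hy x hx

lemma zero (h : SD C) : (0 : E) ∈ C := (h.mem 0).2 (by simp)

lemma add (h : SD C) {x y : E} (hx : x ∈ C) (hy : y ∈ C) : x + y ∈ C :=
  (h.mem _).2 fun z hz => by
    rw [inner_add_right]; exact add_nonneg (h.inn hz hx) (h.inn hz hy)

lemma smul (h : SD C) {t : ℝ} (ht : 0 ≤ t) {x : E} (hx : x ∈ C) : t • x ∈ C :=
  (h.mem _).2 fun z hz => by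
    rw [inner_smul_right]; exact mul_nonneg ht (h.inn hz hx)

lemma closed (h : SD C) : IsClosed C := by
  have : C = ⋂ x ∈ C, {y : E | 0 ≤ ⟪x, y⟫} := by
    ext y; simp only [Set.mem_iInter, Set.mem_ofPred_eq]; exact h.mem y
  rw [this]
  exact isClosed_biInter fun x _ => isClosed_le continuous_const (by fun_prop)

lemma convex (h : SD C) : Convex ℝ C := by
  intro x hx y hy a b ha hb _
  exact h.add (h.smul ha hx) (h.smul hb hy)

lemma pointed (h : SD C) {x : E} (hx : x ∈ C) (hx' : -x ∈ C) : x = 0 := by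
  have := h.inn hx hx'
  rw [inner_neg_right] at this
  have h2 := real_inner_self_nonneg (x := x)
  exact inner_self_eq_zero (𝕜 := ℝ).1 (by linarith)

lemma int_pos (h : SD C) {x : E} (hx : x ∈ interior C) : ∃ r > 0, ∀ c ∈ C, r * ‖c‖ ≤ ⟪x, c⟫ := by
  obtain ⟨r, hr, hb⟩ := Metric.mem_nhds_iff.1 (mem_interior_iff_mem_nhds.1 hx)
  refine ⟨r / 2, by positivity, fun c hc => ?_⟩
  by_cases hc0 : c = 0
  · simp [hc0]
  have hn : 0 < ‖c‖ := norm_pos_iff.2 hc0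
  have hm : x - (r / 2 / ‖c‖) • c ∈ C := by
    apply hb
    rw [Metric.mem_ball, dist_eq_norm]
    simp only [sub_sub_cancel_left, norm_neg, norm_smul, norm_div, Real.norm_eq_abs, abs_norm]
    rw [div_mul_cancel₀ _ hn.ne', abs_of_pos hr]
    simp; linarith
  have := h.inn hm hc
  rw [inner_sub_left, inner_smul_left, real_inner_self_eq_norm_sq] at this
  simp only [conj_trivial] at this
  have e : r / 2 / ‖c‖ * ‖c‖ ^ 2 = r / 2 * ‖c‖ := by field_simp
  linarith

lemma int_of (h : SD C) {x : E} {r : ℝ} (hr : 0 < r) (hx : ∀ c ∈ C, r * ‖c‖ ≤ ⟪x, c⟫) :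
    x ∈ interior C := by
  rw [mem_interior_iff_mem_nhds, Metric.mem_nhds_iff]
  refine ⟨r, hr, fun y hy => (h.mem y).2 fun c hc => ?_⟩
  rw [Metric.mem_ball, dist_eq_norm] at hy
  have h1 := hx c hc
  have h2 : ⟪c, y⟫ = ⟪x, c⟫ + ⟪y - x, c⟫ := by
    rw [inner_sub_left, real_inner_comm]; ring
  have h3 := abs_le.1 (abs_real_inner_le_norm (y - x) c)
  have : ‖y - x‖ * ‖c‖ ≤ r * ‖c‖ := by gcongr
  linarith [h3.1]

lemma moreau (h : SD C) (z : E) : ∃ p ∈ C, ∃ q ∈ C, z = p - q ∧ ⟪p, q⟫ = 0 := by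
  obtain ⟨p, hp, hmin⟩ := exists_norm_eq_iInf_of_complete_convex ⟨0, h.zero⟩ h.closed.isComplete
    h.convex z
  rw [norm_eq_iInf_iff_real_inner_le_zero h.convex hp] at hmin
  have h0 := hmin 0 h.zero
  have h2 := hmin ((2:ℝ) • p) (h.smul (by norm_num) hp)
  rw [two_smul, add_sub_cancel_right] at h2
  simp only [zero_sub, inner_neg_right] at h0
  have hz : ⟪z - p, p⟫ = 0 := by linarith
  refine ⟨p, hp, p - z, (h.mem _).2 fun x hx => ?_, by abel, ?_⟩
  · have := hmin x hx
    rw [inner_sub_right, hz] at this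
    rw [real_inner_comm, ← neg_sub, inner_neg_left]; linarith
  · rw [real_inner_comm, ← neg_sub, inner_neg_left, hz]; simp

end SD

/-- infinitesimal automorphisms -/
def lieg (C : Set E) : Submodule ℝ (E →L[ℝ] E) where
  carrier := {X | ∀ x ∈ C, ∀ y ∈ C, ⟪x, y⟫ = 0 → ⟪X x, y⟫ = 0}
  add_mem' := by
    intro X Y hX hY x hx y hy hxy
    simp [inner_add_left, hX x hx y hy hxy, hY x hx y hy hxy]
  zero_mem' := by intro x _ y _ _; simp
  smul_mem' := by
    intro c X hX x hx y hy hxy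
    simp [inner_smul_left, hX x hx y hy hxy]

def Sym (X : E →L[ℝ] E) : Prop := ∀ x y, ⟪X x, y⟫ = ⟪x, X y⟫
def Skew (X : E →L[ℝ] E) : Prop := ∀ x y, ⟪X x, y⟫ = -⟪x, X y⟫
def Pos (C : Set E) : Set (E →L[ℝ] E) := {T | ∀ x ∈ C, T x ∈ C}

lemma adj_mem {X : E →L[ℝ] E} (hX : X ∈ lieg C) : ContinuousLinearMap.adjoint X ∈ lieg C := by
  intro x hx y hy hxy
  rw [ContinuousLinearMap.adjoint_inner_left, real_inner_comm]
  exact hX y hy x hx (by rw [real_inner_comm]; exact hxy)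

lemma PF [Nontrivial E] (h : SD C) {X : E →L[ℝ] E} (hX : X ∈ lieg C) (hs : Sym X) :
    ∃ v ∈ C, v ≠ 0 ∧ ∃ μ : ℝ, X v = μ • v ∧ ∀ z, μ * ‖z‖ ^ 2 ≤ ⟪X z, z⟫ := by
  have hsa : IsSelfAdjoint X := by
    rw [ContinuousLinearMap.isSelfAdjoint_iff_isSymmetric]; exact hs
  obtain ⟨z, hz, hmin⟩ := (isCompact_sphere (0:E) 1).exists_isMinOn
    (NormedSpace.sphere_nonempty.2 zero_le_one) (f := X.reApplyInnerSelf)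
    (X.reApplyInnerSelf_continuous.continuousOn)
  obtain ⟨p, hp, q, hq, rfl, hpq⟩ := h.moreau z
  have hpq' : ⟪q, p⟫ = 0 := by rw [real_inner_comm]; exact hpq
  have e1 : ‖p + q‖ = 1 := by
    have h1 : ‖p - q‖ = 1 := by simpa using hz
    have h2 := norm_add_sq_real p q
    have h3 := norm_sub_sq_real p q
    rw [hpq] at h2 h3
    rw [h1] at h3
    have : ‖p + q‖ ^ 2 = 1 := by linarith
    nlinarith [norm_nonneg (p + q)]
  have e2 : X.reApplyInnerSelf (p + q) = X.reApplyInnerSelf (p - q) := by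
    have a1 := hX p hp q hq hpq
    have a2 := hX q hq p hp hpq'
    simp only [ContinuousLinearMap.reApplyInnerSelf_apply, map_add, map_sub, inner_add_left,
      inner_add_right, inner_sub_left, inner_sub_right, a1, a2]
    simp
  have hne : p + q ≠ 0 := by
    intro h0; rw [h0] at e1; simp at e1
  have hmin' : IsMinOn X.reApplyInnerSelf (Metric.sphere 0 ‖p + q‖) (p + q) := by
    rw [e1]; intro y hy; simp only [Set.mem_ofPred_eq]; rw [e2]; exact hmin hy
  have hev := hsa.hasEigenvector_of_isMinOn hne hmin'
  set μ : ℝ := ⨅ x : {x : E // x ≠ 0}, X.rayleighQuotient x with hμ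
  have hv : X (p + q) = μ • (p + q) := by simpa using hev.apply_eq_smul
  refine ⟨p + q, h.add hp hq, hne, μ, hv, fun z => ?_⟩
  by_cases hz0 : z = 0
  · simp [hz0]
  have hzn : 0 < ‖z‖ := norm_pos_iff.2 hz0
  have := hmin' (show (‖z‖⁻¹ • z) ∈ Metric.sphere (0:E) ‖p + q‖ by
    rw [e1]; simp [norm_smul, hzn.ne'])
  simp only [Set.mem_ofPred_eq, ContinuousLinearMap.reApplyInnerSelf_apply, hv, map_smul,
    inner_smul_left, inner_smul_right, real_inner_self_eq_norm_sq, e1] at this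
  simp only [conj_trivial, one_pow, mul_one, RCLike.re_to_real] at this
  have h4 : ‖z‖ ^ 2 * μ ≤ ‖z‖ ^ 2 * (‖z‖⁻¹ * (‖z‖⁻¹ * ⟪X z, z⟫)) := by gcongr
  have h5 : ‖z‖ ^ 2 * (‖z‖⁻¹ * (‖z‖⁻¹ * ⟪X z, z⟫)) = ⟪X z, z⟫ := by field_simp
  linarith

/-- a symmetric positive op with zero form vanishes -/
lemma sym_zero {X : E →L[ℝ] E} (hs : Sym X) (h0 : ∀ z, ⟪X z, z⟫ = 0) : X = 0 := by
  ext z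
  have h1 := h0 (z + X z)
  have h2 := h0 z
  have h3 := h0 (X z)
  rw [map_add, inner_add_left, inner_add_right, inner_add_right, h2, h3, hs (X z) z] at h1
  have : ⟪X z, X z⟫ = 0 := by linarith
  simpa using this

lemma sym_inj (h : SD C) {e : E} (he : e ∈ interior C) {X : E →L[ℝ] E} (hX : X ∈ lieg C)
    (hs : Sym X) (hXe : X e = 0) : X = 0 := by
  rcases subsingleton_or_nontrivial E with hE | hE
  · ext z; exact Subsingleton.elim _ _
  obtain ⟨r, hr, her⟩ := h.int_pos he
  have key : ∀ Y : E →L[ℝ] E, Y ∈ lieg C → Sym Y → Y e = 0 → ∀ z, 0 ≤ ⟪Y z, z⟫ := by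
    intro Y hY hsY hYe z
    obtain ⟨v, hv, hv0, μ, hμ, hz⟩ := PF h hY hsY
    have h1 : ⟪Y v, e⟫ = 0 := by rw [hsY, hYe]; simp
    rw [hμ, inner_smul_left] at h1
    have h2 := her v hv
    have h3 : 0 < r * ‖v‖ := mul_pos hr (norm_pos_iff.2 hv0)
    rw [real_inner_comm] at h2
    have : μ = 0 := by
      rcases mul_eq_zero.1 h1 with h | h
      · simpa using h
      · linarith
    have := hz z
    simp_all
  apply sym_zero hs
  intro z
  have h1 := key X hX hs hXe z
  have h2 := key (-X) ((lieg C).neg_mem hX) (fun x y => by simp [hs x y]) (by simp [hXe]) z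
  simp at h2
  linarith

end KV

open scoped RealInnerProductSpace
set_option linter.unusedSectionVars false

namespace KV
open NormedSpace
variable {E : Type*} [NormedAddCommGroup E] [InnerProductSpace ℝ E] [FiniteDimensional ℝ E]
variable {C : Set E}

lemma pos_closed (h : SD C) : IsClosed (Pos C) := by
  have : Pos C = ⋂ x ∈ C, {T : E →L[ℝ] E | T x ∈ C} := by
    ext T; simp [Pos]
  rw [this]
  exact isClosed_biInter fun x _ => h.closed.preimage (by fun_prop)

lemma pos_mul {S T : E →L[ℝ] E} (hS : S ∈ Pos C) (hT : T ∈ Pos C) : S * T ∈ Pos C :=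
  fun x hx => hS _ (hT x hx)

lemma pos_one : (1 : E →L[ℝ] E) ∈ Pos C := fun x hx => hx

lemma pos_pow {S : E →L[ℝ] E} (hS : S ∈ Pos C) (n : ℕ) : S ^ n ∈ Pos C := by
  induction n with
  | zero => simpa using pos_one
  | succ n ih => rw [pow_succ]; exact pos_mul ih hS

lemma pos_exp_of_pos (h : SD C) {T : E →L[ℝ] E} (hT : T ∈ Pos C) : exp T ∈ Pos C := by
  intro x hx
  have h1 := exp_series_hasSum_exp' (𝕂 := ℝ) T
  have h2 := h1.mapL (ContinuousLinearMap.apply ℝ E x)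
  refine (h.mem _).2 fun y hy => ?_
  have h3 := h2.mapL (innerSL ℝ y)
  refine h3.nonneg fun n => ?_
  simp only [map_smul, ContinuousLinearMap.apply_apply, innerSL_apply_apply, smul_eq_mul]
  exact mul_nonneg (by positivity) (h.inn hy (pos_pow hT n x hx))

lemma pos_exp (h : SD C) {e : E} (he : e ∈ interior C) {X : E →L[ℝ] E} (hX : X ∈ lieg C) :
    exp X ∈ Pos C := by
  obtain ⟨r, hr, her⟩ := h.int_pos he
  let R : E →L[ℝ] E := (innerSL ℝ e).smulRight e
  have step : ∀ ε : ℝ, 0 < ε → exp (X + ε • R) ∈ Pos C := by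
    intro ε hε
    set Y := X + ε • R with hY
    have hYi : ∀ x y, ⟪Y x, y⟫ = ⟪X x, y⟫ + ε * (⟪e, x⟫ * ⟪e, y⟫) := by
      intro x y
      simp [hY, R, inner_add_left, inner_smul_left]
    let S : Set (E × E) := ((C ∩ Metric.sphere 0 1) ×ˢ (C ∩ Metric.sphere 0 1)) ∩
      {p | ⟪Y p.1, p.2⟫ ≤ 0}
    have hS : IsCompact S := by
      apply IsCompact.inter_right
      · exact ((isCompact_sphere 0 1).inter_left h.closed).prod
          ((isCompact_sphere 0 1).inter_left h.closed)
      · exact isClosed_le (by fun_prop) continuous_const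
    have hSpos : ∀ p ∈ S, 0 < ⟪p.1, p.2⟫ := by
      rintro ⟨x, y⟩ ⟨⟨⟨hx, hx1⟩, ⟨hy, hy1⟩⟩, hle⟩
      simp only [mem_sphere_iff_norm, sub_zero] at hx1 hy1
      simp only [Set.mem_ofPred_eq] at hle
      refine lt_of_le_of_ne (h.inn hx hy) fun h0 => ?_
      rw [hYi, hX x hx y hy h0.symm] at hle
      have a1 := her x hx
      have a2 := her y hy
      rw [hx1] at a1
      rw [hy1] at a2
      have : 0 < ε * (⟪e, x⟫ * ⟪e, y⟫) := by
        apply mul_pos hε (mul_pos _ _) <;> linarith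
      linarith
    obtain ⟨δ, hδ, hSδ⟩ : ∃ δ > 0, ∀ p ∈ S, δ ≤ ⟪p.1, p.2⟫ := by
      rcases S.eq_empty_or_nonempty with h0 | h0
      · exact ⟨1, one_pos, by simp [h0]⟩
      · obtain ⟨p, hp, hm⟩ := hS.exists_isMinOn h0
          (f := fun p : E × E => ⟪p.1, p.2⟫) (by fun_prop)
        exact ⟨_, hSpos p hp, fun q hq => hm hq⟩
    set l := ‖Y‖ / δ with hl
    have hl0 : 0 ≤ l := by positivity
    have unit : ∀ x ∈ C, ∀ y ∈ C, ‖x‖ = 1 → ‖y‖ = 1 → 0 ≤ ⟪Y x, y⟫ + l * ⟪x, y⟫ := by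
      intro x hx y hy hx1 hy1
      by_cases hc : ⟪Y x, y⟫ ≤ 0
      · have := hSδ (x, y) ⟨⟨⟨hx, by simpa using hx1⟩, ⟨hy, by simpa using hy1⟩⟩, hc⟩
        simp only at this
        have h2 : l * δ ≤ l * ⟪x, y⟫ := by gcongr
        have h3 : l * δ = ‖Y‖ := by rw [hl]; field_simp
        have h4 := (abs_le.1 (abs_real_inner_le_norm (Y x) y)).1
        have h5 := Y.le_opNorm x
        rw [hx1] at h5
        rw [hy1] at h4
        linarith
      · have := mul_nonneg hl0 (h.inn hx hy)
        linarith
    have hpos : Y + l • (1 : E →L[ℝ] E) ∈ Pos C := by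
      intro x hx
      refine (h.mem _).2 fun y hy => ?_
      rw [real_inner_comm]
      by_cases hx0 : x = 0
      · simp [hx0]
      by_cases hy0 : y = 0
      · simp [hy0]
      have hxn := norm_pos_iff.2 hx0
      have hyn := norm_pos_iff.2 hy0
      have := unit (‖x‖⁻¹ • x) (h.smul (by positivity) hx) (‖y‖⁻¹ • y) (h.smul (by positivity) hy)
        (by simp [norm_smul, hxn.ne']) (by simp [norm_smul, hyn.ne'])
      simp only [map_smul, inner_smul_left, inner_smul_right, conj_trivial] at this
      have h6 := mul_nonneg (mul_pos hxn hyn).le this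
      have h7 : ‖x‖ * ‖y‖ * (‖x‖⁻¹ * (‖y‖⁻¹ * ⟪Y x, y⟫) + l * (‖x‖⁻¹ * (‖y‖⁻¹ * ⟪x, y⟫)))
        = ⟪Y x, y⟫ + l * ⟪x, y⟫ := by field_simp
      rw [add_apply, inner_add_left]
      simp only [smul_apply, one_apply_eq_self, inner_smul_left,
        conj_trivial]
      linarith
    have e1 : Y = (Y + l • (1 : E →L[ℝ] E)) + (-l) • (1 : E →L[ℝ] E) := by
      rw [neg_smul]; abel
    rw [e1, exp_add' ((Commute.one_right _).smul_right _), exp_scalar]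
    intro x hx
    simp only [mul_smul_comm, mul_one, smul_apply]
    exact h.smul (Real.exp_pos _).le (pos_exp_of_pos h hpos x hx)
  have hlim : Filter.Tendsto (fun ε : ℝ => exp (X + ε • R)) (nhdsWithin 0 (Set.Ioi 0))
      (nhds (exp X)) := by
    have : Continuous (fun ε : ℝ => exp (X + ε • R)) := exp_cont'.comp (by fun_prop)
    have h1 := this.tendsto 0
    simp only [zero_smul, add_zero] at h1
    exact h1.mono_left nhdsWithin_le_nhds
  exact (pos_closed h).mem_of_tendsto hlim (by
    filter_upwards [self_mem_nhdsWithin] with ε hε using step ε hε)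

lemma mem_of_exp (h : SD C) {X : E →L[ℝ] E} (hX : ∀ t : ℝ, exp (t • X) ∈ Pos C) : X ∈ lieg C := by
  intro x hx y hy hxy
  have hd := hasDerivAt_exp_smul_const (𝕂 := ℝ) X 0
  have h1 : HasDerivAt (fun t : ℝ => ⟪exp (t • X) x, y⟫) ⟪X x, y⟫ 0 := by
    have h2 : HasDerivAt (fun t : ℝ => exp (t • X) x) (X x) 0 := by
      have := ((ContinuousLinearMap.apply ℝ E x).hasFDerivAt).comp_hasDerivAt (0:ℝ) hd
      simp only [zero_smul, exp_zero, one_mul] at this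
      exact this
    simpa using h2.inner ℝ (hasDerivAt_const (0:ℝ) y)
  have hm : IsLocalMin (fun t : ℝ => ⟪exp (t • X) x, y⟫) 0 := by
    refine Filter.Eventually.of_forall fun t => ?_
    simp only [zero_smul, exp_zero, one_apply_eq_self, hxy]
    exact h.inn (hX t x hx) hy
  exact hm.hasDerivAt_eq_zero h1

lemma exp_t (h : SD C) {e : E} (he : e ∈ interior C) {X : E →L[ℝ] E} (hX : X ∈ lieg C) (t : ℝ) :
    exp (t • X) ∈ Pos C := pos_exp h he ((lieg C).smul_mem t hX)

lemma adj_pos (h : SD C) {T : E →L[ℝ] E} (hT : T ∈ Pos C) :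
    ContinuousLinearMap.adjoint T ∈ Pos C := by
  intro x hx
  refine (h.mem _).2 fun y hy => ?_
  rw [ContinuousLinearMap.adjoint_inner_right]
  exact h.inn (hT y hy) hx

lemma bracket (h : SD C) {e : E} (he : e ∈ interior C) {X Y : E →L[ℝ] E} (hX : X ∈ lieg C)
    (hY : Y ∈ lieg C) : Y * X - X * Y ∈ lieg C := by
  intro x hx y hy hxy
  have hd1 := hasDerivAt_exp_smul_const (𝕂 := ℝ) Y 0
  have hd2 := hasDerivAt_exp_smul_const (𝕂 := ℝ) (-Y) 0
  have hd : HasDerivAt (fun t : ℝ => exp (t • Y) * X * exp (t • (-Y))) (Y * X - X * Y) 0 := by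
    have := (hd1.mul_const X).mul hd2
    simp only [zero_smul, exp_zero, one_mul, mul_one, mul_neg] at this
    rw [sub_eq_add_neg]
    exact this
  have h1 : HasDerivAt (fun t : ℝ => ⟪(exp (t • Y) * X * exp (t • (-Y))) x, y⟫)
      ⟪(Y * X - X * Y) x, y⟫ 0 := by
    have h2 : HasDerivAt (fun t : ℝ => (exp (t • Y) * X * exp (t • (-Y))) x)
        ((Y * X - X * Y) x) 0 := by
      exact ((ContinuousLinearMap.apply ℝ E x).hasFDerivAt).comp_hasDerivAt (0:ℝ) hd
    simpa using h2.inner ℝ (hasDerivAt_const (0:ℝ) y)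
  have h0 : (fun t : ℝ => ⟪(exp (t • Y) * X * exp (t • (-Y))) x, y⟫) = fun _ => 0 := by
    funext t
    have p1 := exp_t h he hY t
    have p2 := exp_t h he ((lieg C).neg_mem hY) t
    have := hX _ (p2 x hx) _ (adj_pos h p1 y hy) (by
      rw [ContinuousLinearMap.adjoint_inner_right, ← mul_apply_eq_comp, smul_neg,
        exp_mul_neg]
      simpa using hxy)
    rw [ContinuousLinearMap.adjoint_inner_right] at this
    simpa using this
  rw [h0] at h1
  exact h1.unique (hasDerivAt_const _ _)

lemma skew_kill (h : SD C) (hne : (interior C).Nonempty) : ∃ e ∈ interior C,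
    ∀ X ∈ lieg C, Skew X → X e = 0 := by
  obtain ⟨u, hu⟩ := hne
  obtain ⟨r, hr, hur⟩ := h.int_pos hu
  let D : Set E := {x | ∀ c ∈ C, ‖c‖ ≤ ⟪x, c⟫}
  have hDc : IsClosed D := by
    have : D = ⋂ c ∈ C, {x : E | ‖c‖ ≤ ⟪x, c⟫} := by
      ext T; simp [D]
    rw [this]
    exact isClosed_biInter fun x _ => isClosed_le continuous_const (by fun_prop)
  have hDv : Convex ℝ D := by
    intro x hx y hy a b ha hb hab c hc
    rw [inner_add_left, inner_smul_left, inner_smul_left]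
    simp only [conj_trivial]
    have h1 := mul_le_mul_of_nonneg_left (hx c hc) ha
    have h2 := mul_le_mul_of_nonneg_left (hy c hc) hb
    have : ‖c‖ = a * ‖c‖ + b * ‖c‖ := by rw [← add_mul, hab, one_mul]
    linarith
  have hDn : D.Nonempty := by
    refine ⟨r⁻¹ • u, fun c hc => ?_⟩
    rw [inner_smul_left]
    simp only [conj_trivial]
    have := hur c hc
    rw [le_inv_mul_iff₀ hr]; exact this
  obtain ⟨e, heD, hmin⟩ := exists_norm_eq_iInf_of_complete_convex hDn hDc.isComplete hDv 0
  rw [norm_eq_iInf_iff_real_inner_le_zero hDv heD] at hmin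
  have he : e ∈ interior C := h.int_of one_pos (fun c hc => by rw [one_mul]; exact heD c hc)
  refine ⟨e, he, fun X hX hs => ?_⟩
  have hadj : ContinuousLinearMap.adjoint X = -X := by
    symm
    rw [ContinuousLinearMap.eq_adjoint_iff]
    intro x y; simp [hs x y]
  have hea : ∀ t : ℝ, ContinuousLinearMap.adjoint (exp (t • X)) = exp (-(t • X)) := by
    intro t
    rw [← ContinuousLinearMap.star_eq_adjoint, star_exp, star_smul,
      ContinuousLinearMap.star_eq_adjoint, hadj]
    simp
  have hnorm : ∀ (t : ℝ) x, ‖exp (t • X) x‖ = ‖x‖ := by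
    intro t x
    have : ‖exp (t • X) x‖ ^ 2 = ‖x‖ ^ 2 := by
      rw [← real_inner_self_eq_norm_sq, ← ContinuousLinearMap.adjoint_inner_right, hea,
        ← mul_apply_eq_comp, exp_neg_mul]
      simp
    exact (pow_left_inj₀ (norm_nonneg _) (norm_nonneg _) two_ne_zero).1 this
  have hfix : ∀ t : ℝ, exp (t • X) e = e := by
    intro t
    have hm : exp (t • X) e ∈ D := by
      intro c hc
      have e1 : exp (-(t • X)) c ∈ C := by
        rw [← neg_smul]; exact exp_t h he hX _ c hc
      have := heD _ e1
      rw [← hea, ContinuousLinearMap.adjoint_inner_right, hea, ← neg_smul, hnorm] at this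
      exact this
    have h1 := hmin _ hm
    rw [zero_sub, inner_neg_left, inner_sub_right, real_inner_self_eq_norm_sq] at h1
    have h2 := norm_sub_sq_real (exp (t • X) e) e
    rw [hnorm, real_inner_comm] at h2
    have : ‖exp (t • X) e - e‖ ^ 2 ≤ 0 := by linarith
    have h3 : ‖exp (t • X) e - e‖ = 0 := by
      have := sq_nonneg ‖exp (t • X) e - e‖
      exact pow_eq_zero_iff two_ne_zero |>.1 (by linarith)
    exact sub_eq_zero.1 (norm_eq_zero.1 h3)
  have hd := hasDerivAt_exp_smul_const (𝕂 := ℝ) X 0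
  have h2 : HasDerivAt (fun t : ℝ => exp (t • X) e) (X e) 0 := by
    have := ((ContinuousLinearMap.apply ℝ E e).hasFDerivAt).comp_hasDerivAt (0:ℝ) hd
    simp only [zero_smul, exp_zero, one_mul] at this
    exact this
  simp only [hfix] at h2
  exact h2.unique (hasDerivAt_const _ _)

end KV

open scoped RealInnerProductSpace
set_option linter.unusedSectionVars false

namespace KV
open NormedSpace
variable {E : Type*} [NormedAddCommGroup E] [InnerProductSpace ℝ E] [FiniteDimensional ℝ E]
variable {C : Set E}

lemma pos_exp_int {M : E →L[ℝ] E} (h1 : exp M ∈ Pos C) (h2 : exp (-M) ∈ Pos C) (k : ℤ) :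
    exp ((k : ℝ) • M) ∈ Pos C := by
  obtain ⟨n, rfl | rfl⟩ := k.eq_nat_or_neg
  · have : ((n : ℤ) : ℝ) • M = n • M := by simp [Nat.cast_smul_eq_nsmul]
    rw [this, exp_nsmul']
    exact pos_pow h1 n
  · have : ((-(n : ℤ) : ℤ) : ℝ) • M = n • (-M) := by
      simp [Nat.cast_smul_eq_nsmul]
    rw [this, exp_nsmul']
    exact pos_pow h2 n

lemma no_small (h : SD C) (m : Submodule ℝ (E →L[ℝ] E)) (hm : Disjoint m (lieg C)) :
    ∃ r > 0, ∀ M ∈ m, ‖M‖ < r → exp M ∈ Pos C → exp (-M) ∈ Pos C → M = 0 := by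
  by_contra! hcon
  have hex : ∀ n : ℕ, ∃ M ∈ m, ‖M‖ < 1 / ((n:ℝ) + 1) ∧ exp M ∈ Pos C ∧ exp (-M) ∈ Pos C ∧ M ≠ 0 :=
    fun n => hcon _ (by positivity)
  choose M hMm hMn hM1 hM2 hM0 using hex
  have hs : ∀ n, ‖M n‖⁻¹ • M n ∈ Metric.sphere (0 : E →L[ℝ] E) 1 := by
    intro n
    have := norm_pos_iff.2 (hM0 n)
    simp [norm_smul, this.ne']
  obtain ⟨N, hN, φ, hφ, hlim⟩ := (isCompact_sphere (0 : E →L[ℝ] E) 1).tendsto_subseq hs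
  have hNm : N ∈ m := by
    have hc : IsClosed (m : Set (E →L[ℝ] E)) := m.closed_of_finiteDimensional
    exact hc.mem_of_tendsto hlim (Filter.Eventually.of_forall fun n => m.smul_mem _ (hMm _))
  have hM0lim : Filter.Tendsto (fun n => ‖M (φ n)‖) Filter.atTop (nhds 0) := by
    have h1 : Filter.Tendsto (fun n => ‖M n‖) Filter.atTop (nhds 0) :=
      squeeze_zero (fun n => norm_nonneg _) (fun n => (hMn n).le)
        tendsto_one_div_add_atTop_nhds_zero_nat
    exact h1.comp hφ.tendsto_atTop
  have hNg : N ∈ lieg C := by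
    apply mem_of_exp h
    intro t
    let k : ℕ → ℤ := fun n => ⌊t / ‖M (φ n)‖⌋
    have hk : Filter.Tendsto (fun n => (k n : ℝ) * ‖M (φ n)‖) Filter.atTop (nhds t) := by
      have h0 : Filter.Tendsto (fun n => t - ‖M (φ n)‖) Filter.atTop (nhds t) := by
        simpa using tendsto_const_nhds.sub hM0lim
      refine tendsto_of_tendsto_of_tendsto_of_le_of_le h0 tendsto_const_nhds ?_ ?_
      · intro n
        have hp := norm_pos_iff.2 (hM0 (φ n))
        have := Int.lt_floor_add_one (t / ‖M (φ n)‖)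
        rw [div_lt_iff₀ hp] at this
        simp only [k]
        linarith
      · intro n
        have hp := norm_pos_iff.2 (hM0 (φ n))
        have := Int.floor_le (t / ‖M (φ n)‖)
        rw [le_div_iff₀ hp] at this
        exact this
    have h2 := hk.smul hlim
    have h3 := (exp_cont'.tendsto _).comp h2
    refine (pos_closed h).mem_of_tendsto h3 (Filter.Eventually.of_forall fun n => ?_)
    have hp := norm_pos_iff.2 (hM0 (φ n))
    simp only [Function.comp_apply, smul_smul]
    rw [mul_assoc, mul_inv_cancel₀ hp.ne', mul_one]
    exact pos_exp_int (hM1 _) (hM2 _) _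
  have : N = 0 := by
    have := Submodule.disjoint_def.1 hm N hNm hNg
    exact this
  rw [this] at hN
  simp at hN

/-- symmetric part -/
def liep (C : Set E) : Submodule ℝ (E →L[ℝ] E) where
  carrier := {X | X ∈ lieg C ∧ Sym X}
  add_mem' := by
    rintro X Y ⟨hX, hX'⟩ ⟨hY, hY'⟩
    exact ⟨(lieg C).add_mem hX hY, fun x y => by
      simp [inner_add_left, inner_add_right, hX' x y, hY' x y]⟩
  zero_mem' := ⟨(lieg C).zero_mem, fun x y => by simp⟩
  smul_mem' := by
    rintro c X ⟨hX, hX'⟩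
    exact ⟨(lieg C).smul_mem c hX, fun x y => by
      simp [inner_smul_left, inner_smul_right, hX' x y]⟩

/-- skew part -/
def liek (C : Set E) : Submodule ℝ (E →L[ℝ] E) where
  carrier := {X | X ∈ lieg C ∧ Skew X}
  add_mem' := by
    rintro X Y ⟨hX, hX'⟩ ⟨hY, hY'⟩
    exact ⟨(lieg C).add_mem hX hY, fun x y => by
      simp [inner_add_left, inner_add_right, hX' x y, hY' x y]; ring⟩
  zero_mem' := ⟨(lieg C).zero_mem, fun x y => by simp⟩
  smul_mem' := by
    rintro c X ⟨hX, hX'⟩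
    exact ⟨(lieg C).smul_mem c hX, fun x y => by
      simp [inner_smul_left, inner_smul_right, hX' x y]⟩

lemma decomp {X : E →L[ℝ] E} (hX : X ∈ lieg C) : ∃ P ∈ liep C, ∃ K ∈ liek C, X = P + K := by
  have ha := adj_mem hX
  refine ⟨(2⁻¹ : ℝ) • (X + ContinuousLinearMap.adjoint X),
    ⟨(lieg C).smul_mem _ ((lieg C).add_mem hX ha), fun x y => ?_⟩,
    (2⁻¹ : ℝ) • (X - ContinuousLinearMap.adjoint X),
    ⟨(lieg C).smul_mem _ ((lieg C).sub_mem hX ha), fun x y => ?_⟩, ?_⟩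
  · simp [inner_smul_left, inner_smul_right, inner_add_left, inner_add_right,
      ContinuousLinearMap.adjoint_inner_left, ContinuousLinearMap.adjoint_inner_right]
    ring
  · simp [inner_smul_left, inner_smul_right, inner_sub_left, inner_sub_right,
      ContinuousLinearMap.adjoint_inner_left, ContinuousLinearMap.adjoint_inner_right]
    ring
  · rw [← smul_add, add_add_sub_cancel, ← two_smul ℝ X, smul_smul]; norm_num

/-- automorphisms -/
def Aut (C : Set E) : Set (E →L[ℝ] E) :=
  {T | T ∈ Pos C ∧ ∃ T' ∈ Pos C, T * T' = 1 ∧ T' * T = 1}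

lemma three_exp {W A : Type*} [NormedAddCommGroup W] [NormedSpace ℝ W] [CompleteSpace W]
    [NormedRing A] [NormedAlgebra ℝ A] [CompleteSpace A] (a1 a2 a3 : W →L[ℝ] A)
    (hsurj : ((a1 + a2 + a3 : W →L[ℝ] A) : W →ₗ[ℝ] A).range = ⊤) :
    Filter.map (fun p => exp (a2 p) * exp (a1 p) * exp (a3 p)) (nhds 0) = nhds 1 := by
  have hexp : ∀ a : W →L[ℝ] A, HasStrictFDerivAt (fun p => exp (a p)) a 0 := by
    intro a
    have h0 : HasStrictFDerivAt (exp : A → A) (1 : A →L[ℝ] A) (a 0) := by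
      rw [map_zero]; exact hasStrictFDerivAt_exp_zero
    exact h0.comp (0 : W) a.hasStrictFDerivAt
  have hF : HasStrictFDerivAt (fun p => exp (a2 p) * exp (a1 p) * exp (a3 p)) (a1 + a2 + a3) 0 := by
    have := ((hexp a2).mul' (hexp a1)).mul' (hexp a3)
    refine HasStrictFDerivAt.congr_fderiv this ?_
    ext p
    simp
    abel
  have hmap := hF.map_nhds_eq_of_surj hsurj
  simpa using hmap

lemma three_sub {A : Type*} [NormedRing A] [NormedAlgebra ℝ A] [FiniteDimensional ℝ A]
    (m p k : Submodule ℝ A) (hs : ∀ X, ∃ M ∈ m, ∃ P ∈ p, ∃ K ∈ k, X = M + P + K) {r : ℝ}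
    (hr : 0 < r) :
    ∀ᶠ T in nhds (1 : A), ∃ M ∈ m, ∃ P ∈ p, ∃ K ∈ k, ‖M‖ < r ∧ T = exp P * exp M * exp K := by
  have : CompleteSpace A := FiniteDimensional.complete ℝ A
  let a1 : m × p × k →L[ℝ] A :=
    m.subtypeL.comp (ContinuousLinearMap.fst ℝ _ _)
  let a2 : m × p × k →L[ℝ] A :=
    p.subtypeL.comp ((ContinuousLinearMap.fst ℝ _ _).comp (ContinuousLinearMap.snd ℝ _ _))
  let a3 : m × p × k →L[ℝ] A :=
    k.subtypeL.comp ((ContinuousLinearMap.snd ℝ _ _).comp (ContinuousLinearMap.snd ℝ _ _))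
  have hsurj : ((a1 + a2 + a3 : m × p × k →L[ℝ] A) : m × p × k →ₗ[ℝ] A).range = ⊤ := by
    rw [LinearMap.range_eq_top]
    intro X
    obtain ⟨M, hM, P, hP, K, hK, rfl⟩ := hs X
    exact ⟨(⟨M, hM⟩, ⟨P, hP⟩, ⟨K, hK⟩), by simp [a1, a2, a3]⟩
  have hmap := three_exp a1 a2 a3 hsurj
  have hball : {q : m × p × k | ‖a1 q‖ < r} ∈ nhds (0 : m × p × k) := by
    apply IsOpen.mem_nhds
    · exact isOpen_lt (by fun_prop) continuous_const
    · simpa using hr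
  have himg := Filter.image_mem_map (m := fun q => exp (a2 q) * exp (a1 q) * exp (a3 q)) hball
  rw [hmap] at himg
  filter_upwards [himg] with T hT
  obtain ⟨⟨⟨M, hM⟩, ⟨P, hP⟩, ⟨K, hK⟩⟩, hp, rfl⟩ := hT
  exact ⟨M, hM, P, hP, K, hK, hp, rfl⟩

lemma local_struct (h : SD C) {e : E} (he : e ∈ interior C)
    (hk : ∀ X ∈ lieg C, Skew X → X e = 0) :
    ∀ᶠ T in nhds (1 : E →L[ℝ] E), T ∈ Aut C → ∃ P ∈ liep C, T e = exp P e := by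
  obtain ⟨m, hm⟩ := Submodule.exists_isCompl (lieg C)
  obtain ⟨r, hr, hsmall⟩ := no_small h m hm.disjoint.symm
  have h3 := three_sub m (liep C) (liek C) (fun X => by
    have hX : X ∈ lieg C ⊔ m := by rw [hm.sup_eq_top]; trivial
    obtain ⟨Y, hY, M, hM, rfl⟩ := Submodule.mem_sup.1 hX
    obtain ⟨P, hP, K, hK, rfl⟩ := decomp hY
    exact ⟨M, hM, P, hP, K, hK, by abel⟩) hr
  filter_upwards [h3] with T hT hTA
  obtain ⟨M, hM, P, hP, K, hK, hp, rfl⟩ := hT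
  obtain ⟨hpos, T', hT', h1, h2⟩ := hTA
  have hMe : exp M = exp (-P) * (exp P * exp M * exp K) * exp (-K) := by
    calc exp M = (exp (-P) * exp P) * exp M * (exp K * exp (-K)) := by
          rw [exp_neg_mul, exp_mul_neg]; simp
      _ = _ := by noncomm_ring
  have hMe' : exp (-M) = exp K * T' * exp P := by
    have e1 : exp M * (exp K * T' * exp P) = 1 := by
      calc exp M * (exp K * T' * exp P)
          = (exp (-P) * exp P) * exp M * (exp K * T' * exp P) := by
            rw [exp_neg_mul]; simp
        _ = exp (-P) * ((exp P * exp M * exp K) * T') * exp P := by noncomm_ring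
        _ = 1 := by rw [h1, mul_one, exp_neg_mul]
    calc exp (-M) = exp (-M) * (exp M * (exp K * T' * exp P)) := by rw [e1, mul_one]
      _ = (exp (-M) * exp M) * (exp K * T' * exp P) := by noncomm_ring
      _ = _ := by rw [exp_neg_mul, one_mul]
  have hPg : P ∈ lieg C := hP.1
  have hKg : K ∈ lieg C := hK.1
  have hM0 : M = 0 := by
    apply hsmall M hM hp
    · rw [hMe]
      exact pos_mul (pos_mul (pos_exp h he ((lieg C).neg_mem hPg)) hpos)
        (pos_exp h he ((lieg C).neg_mem hKg))
    · rw [hMe']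
      exact pos_mul (pos_mul (pos_exp h he hKg) hT') (pos_exp h he hPg)
  refine ⟨P, hP, ?_⟩
  have hKe : exp K e = e := by
    have hK0 := hk K hKg hK.2
    have h1 := exp_series_hasSum_exp' (𝕂 := ℝ) K
    have h2 := h1.mapL (ContinuousLinearMap.apply ℝ E e)
    refine h2.unique ?_
    convert hasSum_single (0 : ℕ) ?_ using 1
    · simp
    · intro n hn
      obtain ⟨k, rfl⟩ := Nat.exists_eq_succ_of_ne_zero hn
      simp [pow_succ, hK0]
  rw [hM0]
  simp [hKe]

lemma contDiff_exp' : ContDiff ℝ 1 (exp : (E →L[ℝ] E) → (E →L[ℝ] E)) :=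
  contDiff_iff_contDiffAt.2 fun x => (exp_analytic (𝕂 := ℝ) x).contDiffAt

lemma dimH_exp_aux {W : Type*} [NormedAddCommGroup W] [NormedSpace ℝ W] [FiniteDimensional ℝ W]
    (a : W →L[ℝ] (E →L[ℝ] E)) (g : E →L[ℝ] E) (e : E) :
    dimH (Set.range (fun P : W => g (exp (a P) e))) ≤ (Module.finrank ℝ W : ENNReal) := by
  refine ContDiff.dimH_range_le ?_
  have h1 : ContDiff ℝ 1 (fun P : W => exp (a P)) := contDiff_exp'.comp a.contDiff
  exact g.contDiff.comp (h1.clm_apply contDiff_const)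

lemma dimH_exp_le (p : Submodule ℝ (E →L[ℝ] E)) (t : Set (E →L[ℝ] E)) (ht : t.Countable) (e : E)
    (s : Set E) (hs : ∀ x ∈ s, ∃ g ∈ t, ∃ P ∈ p, x = g (exp P e)) :
    dimH s ≤ (Module.finrank ℝ p : ENNReal) := by
  let q := (Module.finBasis ℝ p).equivFun
  let a : (Fin (Module.finrank ℝ p) → ℝ) →L[ℝ] (E →L[ℝ] E) :=
    LinearMap.toContinuousLinearMap (p.subtype.comp q.symm.toLinearMap)
  have hsub : s ⊆ ⋃ g ∈ t, Set.range (fun P => g (exp (a P) e)) := by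
    intro x hx
    obtain ⟨g, hg, P, hP, hPe⟩ := hs x hx
    refine Set.mem_iUnion₂.2 ⟨g, hg, q ⟨P, hP⟩, ?_⟩
    have : a (q ⟨P, hP⟩) = P := by simp [a]
    simp only [this, hPe]
  refine (dimH_mono hsub).trans ?_
  rw [dimH_bUnion ht]
  refine iSup₂_le fun g _ => (dimH_exp_aux a g e).trans ?_
  simp

lemma dim_le (h : SD C) {e : E} (he : e ∈ interior C)
    (hk : ∀ X ∈ lieg C, Skew X → X e = 0)
    (hhom : ∀ x ∈ interior C, ∃ g ∈ Aut C, g e = x) :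
    Module.finrank ℝ E ≤ Module.finrank ℝ (liep C) := by
  have hloc := local_struct h he hk
  let V : Set (E →L[ℝ] E) := {T | T ∈ Aut C → ∃ P ∈ liep C, T e = exp P e}
  have hV : V ∈ nhds 1 := hloc
  have hcov : ∀ g ∈ Aut C, {T | ∃ P ∈ liep C, T e = g (exp P e)} ∈ nhdsWithin g (Aut C) := by
    rintro g ⟨hg, g', hg', h1, h2⟩
    have hc : Filter.Tendsto (fun T : E →L[ℝ] E => g' * T) (nhds g) (nhds 1) := by
      have : Continuous (fun T : E →L[ℝ] E => g' * T) := by fun_prop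
      have h3 := this.tendsto g
      rwa [h2] at h3
    filter_upwards [nhdsWithin_le_nhds (hc hV), self_mem_nhdsWithin] with T hT hTA
    obtain ⟨hTp, T', hT', h3, h4⟩ := hTA
    have hA : g' * T ∈ Aut C := by
      refine ⟨pos_mul hg' hTp, T' * g, pos_mul hT' hg, ?_, ?_⟩
      · calc g' * T * (T' * g) = g' * (T * T') * g := by noncomm_ring
          _ = 1 := by rw [h3, mul_one, h2]
      · calc T' * g * (g' * T) = T' * (g * g') * T := by noncomm_ring
          _ = 1 := by rw [h1, mul_one, h4]
    obtain ⟨P, hP, hPe⟩ := hT hA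
    refine ⟨P, hP, ?_⟩
    rw [← hPe, ← mul_apply_eq_comp, ← mul_assoc, h1, one_mul]
  obtain ⟨t, htA, htc, hcover⟩ := TopologicalSpace.countable_cover_nhdsWithin hcov
  have hd1 : dimH (interior C) = Module.finrank ℝ E :=
    Real.dimH_of_mem_nhds (isOpen_interior.mem_nhds he)
  have hd2 := dimH_exp_le (liep C) t htc e (interior C) (by
    intro x hx
    obtain ⟨T, hT, rfl⟩ := hhom x hx
    obtain ⟨g, hg, P, hP, hPe⟩ := Set.mem_iUnion₂.1 (hcover hT)
    exact ⟨g, hg, P, hP, hPe⟩)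
  rw [hd1] at hd2
  exact_mod_cast hd2

/-- the multiplication operators -/
lemma exists_L (h : SD C) {e : E} (he : e ∈ interior C)
    (hk : ∀ X ∈ lieg C, Skew X → X e = 0)
    (hhom : ∀ x ∈ interior C, ∃ g ∈ Aut C, g e = x) :
    ∃ L : E →ₗ[ℝ] (E →L[ℝ] E), (∀ x, L x ∈ liep C) ∧ (∀ x, L x e = x) ∧
      ∀ X ∈ liep C, X = L (X e) := by
  let ev : liep C →ₗ[ℝ] E :=
    (ContinuousLinearMap.apply ℝ E e : (E →L[ℝ] E) →ₗ[ℝ] E).comp (liep C).subtype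
  have hinj : Function.Injective ev := by
    rw [injective_iff_map_eq_zero]
    rintro ⟨X, hX⟩ h0
    have : X = 0 := sym_inj h he hX.1 hX.2 h0
    simp [this]
  have hdim : Module.finrank ℝ (liep C) = Module.finrank ℝ E :=
    le_antisymm (LinearMap.finrank_le_finrank_of_injective hinj) (dim_le h he hk hhom)
  let eq := LinearEquiv.ofInjectiveOfFinrankEq ev hinj hdim
  have heq : ∀ X, eq X = ev X := fun X => rfl
  refine ⟨(liep C).subtype.comp (eq.symm : E →ₗ[ℝ] liep C), fun x => (eq.symm x).2, ?_, ?_⟩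
  · intro x
    exact eq.apply_symm_apply x
  · intro X hX
    have := eq.symm_apply_apply ⟨X, hX⟩
    have h2 := congrArg (Subtype.val) this
    exact h2.symm
end KV

open scoped RealInnerProductSpace
set_option linter.unusedSectionVars false

namespace KV
open NormedSpace
variable {E : Type*} [NormedAddCommGroup E] [InnerProductSpace ℝ E] [FiniteDimensional ℝ E]
variable {C : Set E}

/-- data of the multiplication operators -/
structure LD (C : Set E) (e : E) (L : E →ₗ[ℝ] (E →L[ℝ] E)) : Prop where
  sd : SD C
  he : e ∈ interior C
  hk : ∀ X ∈ lieg C, Skew X → X e = 0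
  mem : ∀ x, L x ∈ lieg C
  sym : ∀ x, Sym (L x)
  unit : ∀ x, L x e = x
  uniq : ∀ X ∈ lieg C, Sym X → X = L (X e)

namespace LD
variable {e : E} {L : E →ₗ[ℝ] (E →L[ℝ] E)}

lemma br_mem (h : LD C e L) (x y : E) : L x * L y - L y * L x ∈ lieg C :=
  bracket h.sd h.he (h.mem y) (h.mem x)

lemma br_skew (h : LD C e L) (x y : E) : Skew (L x * L y - L y * L x) := by
  intro a b
  simp only [sub_apply, mul_apply_eq_comp, inner_sub_left, inner_sub_right]
  rw [h.sym x, h.sym y, h.sym y, h.sym x]; ring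

lemma br_e (h : LD C e L) (x y : E) : (L x * L y - L y * L x) e = 0 :=
  h.hk _ (h.br_mem x y) (h.br_skew x y)

lemma comm (h : LD C e L) (x y : E) : L x y = L y x := by
  have := h.br_e x y
  simp only [sub_apply, mul_apply_eq_comp, h.unit] at this
  exact sub_eq_zero.1 this

lemma der (h : LD C e L) (x y z w : E) :
    L x (L y (L z w)) - L y (L x (L z w)) - (L z (L x (L y w)) - L z (L y (L x w)))
      = L (L x (L y z)) w - L (L y (L x z)) w := by
  set D := L x * L y - L y * L x with hD
  have hm : D * L z - L z * D ∈ lieg C := bracket h.sd h.he (h.mem z) (h.br_mem x y)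
  have hs : Sym (D * L z - L z * D) := by
    intro a b
    have hsk := h.br_skew x y
    simp only [sub_apply (f := D * L z), mul_apply_eq_comp (f := D), mul_apply_eq_comp (f := L z),
      inner_sub_left, inner_sub_right]
    rw [hsk, h.sym z, h.sym z, hsk]; ring
  have h1 := h.uniq _ hm hs
  have h2 : (D * L z - L z * D) e = D z := by
    have := h.br_e x y
    rw [sub_apply, mul_apply_eq_comp, mul_apply_eq_comp, h.unit, this]; simp
  rw [h2] at h1
  have h3 := congrArg (fun T : E →L[ℝ] E => T w) h1
  simpa [hD] using h3

lemma jid (h : LD C e L) (a z w : E) :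
    L a (L a (L z w)) - L (L a a) (L z w)
      = (2:ℝ) • L (L a z) (L a w) - L (L a (L a z)) w - L z (L a (L a w)) := by
  apply ext_inner_left ℝ
  intro y
  have h0 := congrArg (fun q => ⟪q, w⟫) (h.der a y a z)
  simp only [inner_sub_left] at h0
  have i1 : ⟪L a (L y (L a z)), w⟫ = ⟪y, L (L a z) (L a w)⟫ := by
    rw [h.sym a, h.comm y, h.sym]
  have i2 : ⟪L y (L a (L a z)), w⟫ = ⟪y, L (L a (L a z)) w⟫ := by
    rw [h.comm y, h.sym]
  have i3 : ⟪L a (L a (L y z)), w⟫ = ⟪y, L z (L a (L a w))⟫ := by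
    rw [h.sym a, h.sym a, h.comm y, h.sym]
  have i4 : ⟪L (L a (L y a)) z, w⟫ = ⟪y, L a (L a (L z w))⟫ := by
    rw [h.comm _ z, h.sym z, h.sym a, h.comm y, h.sym a]
  have i5 : ⟪L (L y (L a a)) z, w⟫ = ⟪y, L (L a a) (L z w)⟫ := by
    rw [h.comm _ z, h.sym z, h.comm y, h.sym]
  simp only [inner_sub_right, inner_smul_right]
  linarith

lemma jordan (h : LD C e L) (a w : E) : L (L a a) (L a w) = L a (L (L a a) w) := by
  have h1 := h.jid a a w
  have h2 : L a (L a (L a w)) - L a (L (L a a) w)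
      = (2:ℝ) • L a (L (L a a) w) - L (L a (L a a)) w - L a (L a (L a w)) := by
    apply ext_inner_left ℝ
    intro v
    have h3 := congrArg (fun q => ⟪q, w⟫) (h.jid a a v)
    simp only [inner_sub_left, inner_smul_left, conj_trivial, h.sym _ _ w, h.sym _ _ (L _ _),
      h.sym _ _ ((L _) (L _ _))] at h3
    simp only [inner_sub_right, inner_smul_right]
    linarith
  have h3 : (3:ℝ) • L (L a a) (L a w) = (3:ℝ) • L a (L (L a a) w) := by
    have e1 : (3:ℝ) • L (L a a) (L a w) = L a (L a (L a w)) + L (L a (L a a)) w + L a (L a (L a w)) := by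
      have h4 := sub_eq_zero.2 h1
      rw [← sub_eq_zero, ← neg_eq_zero, ← h4]; module
    have e2 : (3:ℝ) • L a (L (L a a) w) = L a (L a (L a w)) + L (L a (L a a)) w + L a (L a (L a w)) := by
      have h4 := sub_eq_zero.2 h2
      rw [← sub_eq_zero, ← neg_eq_zero, ← h4]; module
    rw [e1, e2]
  exact smul_right_injective E (by norm_num : (3:ℝ) ≠ 0) h3

lemma Lpos [Nontrivial E] (h : LD C e L) {w : E} (hw : w ∈ C) (z : E) : 0 ≤ ⟪L w z, z⟫ := by
  obtain ⟨v, hv, hv0, μ, hμ, hz⟩ := PF h.sd (h.mem w) (h.sym w)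
  obtain ⟨r, hr, her⟩ := h.sd.int_pos h.he
  have h1 : ⟪L w v, e⟫ = ⟪v, w⟫ := by rw [h.sym, h.unit]
  rw [hμ, inner_smul_left, conj_trivial] at h1
  have h2 := her v hv
  rw [real_inner_comm] at h2
  have h3 : 0 < r * ‖v‖ := mul_pos hr (norm_pos_iff.2 hv0)
  have h4 := h.sd.inn hv hw
  have h5 : 0 ≤ μ := by
    by_contra hc
    push Not at hc
    have := mul_neg_of_neg_of_pos hc (h3.trans_le h2)
    linarith
  exact (mul_nonneg h5 (sq_nonneg _)).trans (hz z)

lemma sq_mem [Nontrivial E] (h : LD C e L) (z : E) : L z z ∈ C := by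
  refine (h.sd.mem _).2 fun w hw => ?_
  have := h.Lpos hw z
  have e1 : ⟪w, L z z⟫ = ⟪L w z, z⟫ := by rw [← h.sym z w z, h.comm z w]
  rw [e1]; exact this

lemma sq_cont (L : E →ₗ[ℝ] (E →L[ℝ] E)) : Continuous (fun z => L z z) := by
  have : Continuous L := L.continuous_of_finiteDimensional
  exact this.clm_apply continuous_id

lemma sq_closure (h : LD C e L) (S : Set E) {y : E} (hy : y ∈ closure ((fun z => L z z) '' S)) :
    ∃ z ∈ closure S, L z z = y := by
  obtain ⟨s, hs, hlim⟩ := mem_closure_iff_seq_limit.1 hy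
  choose z hzS hz using hs
  have hn : ∀ n, ‖z n‖ ^ 2 ≤ ‖s n‖ * ‖e‖ := by
    intro n
    have h1 : ⟪L (z n) (z n), e⟫ = ‖z n‖ ^ 2 := by
      rw [h.sym, h.unit, real_inner_self_eq_norm_sq]
    rw [← h1, ← hz n]
    exact real_inner_le_norm _ _
  obtain ⟨R, hR⟩ := (Metric.isBounded_range_of_tendsto s hlim).exists_norm_le
  have hb : ∀ n, z n ∈ Metric.closedBall (0:E) (R * ‖e‖ + 1) := by
    intro n
    have h1 := hn n
    have h2 : ‖s n‖ * ‖e‖ ≤ R * ‖e‖ := by gcongr; exact hR _ ⟨n, rfl⟩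
    rw [mem_closedBall_zero_iff]
    nlinarith [norm_nonneg (z n)]
  obtain ⟨z0, _, φ, hφ, hzl⟩ := (isCompact_closedBall (0:E) (R * ‖e‖ + 1)).tendsto_subseq hb
  refine ⟨z0, mem_closure_of_tendsto hzl (Filter.Eventually.of_forall fun n => hzS _), ?_⟩
  have h1 := ((sq_cont L).tendsto z0).comp hzl
  have h2 := hlim.comp hφ.tendsto_atTop
  refine tendsto_nhds_unique h1 (h2.congr fun n => ?_)
  exact (hz _).symm

lemma int_sub [Nontrivial E] (h : LD C e L) : interior C ⊆ (fun z => L z z) '' Set.univ := by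
  let U : Set E := {z | ∃ r > 0, ∀ v, r * ‖v‖ ^ 2 ≤ ⟪L z v, v⟫}
  have hLc : Continuous L := L.continuous_of_finiteDimensional
  have hU : IsOpen U := by
    rw [isOpen_iff_mem_nhds]
    rintro z ⟨r, hr, hz⟩
    have : {z' | ‖L z' - L z‖ < r / 2} ∈ nhds z := by
      apply IsOpen.mem_nhds
      · exact isOpen_lt (by fun_prop) continuous_const
      · simpa using hr
    filter_upwards [this] with z' hz'
    refine ⟨r / 2, by positivity, fun v => ?_⟩
    have h1 := hz v
    have h2 := (abs_le.1 (abs_real_inner_le_norm ((L z' - L z) v) v)).1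
    have h3 := (L z' - L z).le_opNorm v
    have h4 : ‖(L z' - L z) v‖ * ‖v‖ ≤ r / 2 * ‖v‖ * ‖v‖ := by
      gcongr
      exact h3.trans (by gcongr)
    rw [sub_apply, inner_sub_left] at h2
    rw [sub_apply] at h4
    nlinarith
  have hV : IsOpen ((fun z => L z z) '' U) := by
    rw [isOpen_iff_mem_nhds]
    rintro _ ⟨z, hz, rfl⟩
    let Lc : E →L[ℝ] (E →L[ℝ] E) := LinearMap.toContinuousLinearMap L
    have hd : HasStrictFDerivAt (fun z => L z z) ((2:ℝ) • L z) z := by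
      have h1 : HasStrictFDerivAt (fun z => Lc z) Lc z := Lc.hasStrictFDerivAt
      have h2 := h1.clm_apply (hasStrictFDerivAt_id z)
      refine HasStrictFDerivAt.congr_fderiv h2 ?_
      ext v
      have := h.comm v z
      simp [Lc, this, two_smul]
    have hs : (((2:ℝ) • L z : E →L[ℝ] E) : E →ₗ[ℝ] E).range = ⊤ := by
      rw [LinearMap.range_eq_top, ← LinearMap.injective_iff_surjective, injective_iff_map_eq_zero]
      intro v hv
      obtain ⟨r, hr, hz⟩ := hz
      have h1 : L z v = 0 := by simpa using hv
      have h2 := hz v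
      rw [h1, inner_zero_left] at h2
      have h3 : ‖v‖ ^ 2 ≤ 0 := by
        by_contra hc
        push Not at hc
        have := mul_pos hr hc
        linarith
      have h4 : ‖v‖ = 0 := by nlinarith [norm_nonneg v]
      exact norm_eq_zero.1 h4
    have hmap := hd.map_nhds_eq_of_surj hs
    have := Filter.image_mem_map (m := fun z => L z z) (hU.mem_nhds hz)
    rwa [hmap] at this
  have hLe : L e = 1 := by
    have := h.uniq 1 (fun x _ y _ hxy => by simpa using hxy) (fun x y => by simp)
    simpa using this.symm
  have heU : e ∈ U := ⟨1, one_pos, fun v => by rw [hLe]; simp⟩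
  have hsub : interior C ⊆ (fun z => L z z) '' U := by
    refine (h.sd.convex.interior.isPreconnected).subset_of_closure_inter_subset hV
      ⟨e, h.he, e, heU, h.unit e⟩ ?_
    rintro y ⟨hy, hyC⟩
    obtain ⟨z, hz, rfl⟩ := h.sq_closure U hy
    refine ⟨z, ?_, rfl⟩
    have hzp : ∀ v, 0 ≤ ⟪L z v, v⟫ := by
      intro v
      have hc : IsClosed {z : E | 0 ≤ ⟪L z v, v⟫} := isClosed_le continuous_const (by fun_prop)
      refine hc.closure_subset_iff.2 ?_ hz
      rintro z' ⟨r, hr, hz'⟩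
      exact (by positivity : 0 ≤ r * ‖v‖ ^ 2).trans (hz' v)
    obtain ⟨v, hv, hv0, μ, hμ, hm⟩ := PF h.sd (h.mem z) (h.sym z)
    refine ⟨μ, ?_, hm⟩
    have hvn := norm_pos_iff.2 hv0
    have h1 := hzp v
    rw [hμ, inner_smul_left, real_inner_self_eq_norm_sq, conj_trivial] at h1
    have h2 : 0 ≤ μ := by
      by_contra hc
      push Not at hc
      have := mul_neg_of_neg_of_pos hc (by positivity : 0 < ‖v‖ ^ 2)
      linarith
    refine lt_of_le_of_ne h2 fun h0 => ?_
    obtain ⟨r, hr, hrr⟩ := h.sd.int_pos hyC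
    have h3 := hrr v hv
    rw [h.sym, hμ, ← h0] at h3
    simp only [zero_smul, inner_zero_right] at h3
    have := mul_pos hr hvn
    linarith
  exact hsub.trans (Set.image_mono (Set.subset_univ _))

lemma sq_eq [Nontrivial E] (h : LD C e L) : {z : E | ∃ a : E, L a a = z} = C := by
  ext y
  constructor
  · rintro ⟨a, rfl⟩; exact h.sq_mem a
  · intro hy
    have h1 : y ∈ closure (interior C) := by
      rw [h.sd.convex.closure_interior_eq_closure_of_nonempty_interior ⟨e, h.he⟩]
      exact subset_closure hy
    obtain ⟨z, _, hz⟩ := h.sq_closure Set.univ (closure_mono h.int_sub h1)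
    exact ⟨z, hz⟩

end LD

/-- the four properties -/
def Good (C : Set E) (u : E) (m : E →ₗ[ℝ] E →ₗ[ℝ] E) : Prop :=
      (∀ a b : E, m a b = m b a) ∧
      (∀ a b : E, m (m a a) (m a b) = m a (m (m a a) b)) ∧
      (∀ a : E, m u a = a) ∧
      {z : E | ∃ a : E, m a a = z} = C

lemma cs {m : E →ₗ[ℝ] E →ₗ[ℝ] E} (hc : ∀ a b : E, m a b = m b a) {w : E}
    (hw : ∀ a, 0 ≤ ⟪m a a, w⟫) {a : E} (ha : ⟪m a a, w⟫ = 0) (b : E) : ⟪m a b, w⟫ = 0 := by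
  by_contra hne
  set p := ⟪m a b, w⟫ with hp
  have h1 := hw (b + (-(⟪m b b, w⟫ + 1) / (2 * p)) • a)
  simp only [map_add, map_smul, LinearMap.add_apply, LinearMap.smul_apply, inner_add_left,
    inner_smul_left, conj_trivial, ha, hc b a, ← hp] at h1
  have : -(⟪m b b, w⟫ + 1) / (2 * p) * p = -(⟪m b b, w⟫ + 1) / 2 := by field_simp
  rw [this] at h1
  linarith

lemma Good.mem {u : E} {m : E →ₗ[ℝ] E →ₗ[ℝ] E} (h : SD C) (hm : Good C u m) (x : E) :
    LinearMap.toContinuousLinearMap (m x) ∈ lieg C := by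
  obtain ⟨hc, hj, hu, hsq⟩ := hm
  intro c hcC w hw hcw
  have hC : ∀ a, m a a ∈ C := fun a => by rw [← hsq]; exact ⟨a, rfl⟩
  have hpos : ∀ a, 0 ≤ ⟪m a a, w⟫ := fun a => h.inn (hC a) hw
  rw [← hsq] at hcC
  obtain ⟨a, rfl⟩ := hcC
  have h1 := cs hc hpos hcw (m a (m a a))
  have h2 : ⟪m (m a a) (m a a), w⟫ = 0 := by
    rw [hj a a, hc (m a a) a]; exact h1
  have h3 := cs hc hpos h2 x
  rw [hc] at h3
  exact h3

lemma LD.good [Nontrivial E] {e : E} {L : E →ₗ[ℝ] (E →L[ℝ] E)} (h : LD C e L) :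
    ∃ m0, Good C e m0 ∧ ∀ m, Good C e m → m = m0 := by
  let m0 : E →ₗ[ℝ] E →ₗ[ℝ] E := (ContinuousLinearMap.coeLM ℝ).comp L
  have hm0 : ∀ a b, m0 a b = L a b := fun a b => rfl
  refine ⟨m0, ⟨h.comm, h.jordan, fun a => ?_, h.sq_eq⟩, fun m hm => ?_⟩
  · rw [hm0, h.comm, h.unit]
  have hc := hm.1
  have hsk : ∀ a y z, ⟪m a y - L a y, z⟫ = - ⟪y, m a z - L a z⟫ := by
    intro a
    obtain ⟨P, ⟨hP1, hP2⟩, K, ⟨hK1, hK2⟩, hX⟩ := decomp (hm.mem h.sd a)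
    have hX' : ∀ y, m a y = P y + K y := fun y => by
      have := congrArg (fun T : E →L[ℝ] E => T y) hX
      simpa using this
    have hKe := h.hk K hK1 hK2
    have hPe : P e = a := by
      have := hX' e
      rw [hKe, add_zero, hc, hm.2.2.1] at this
      exact this.symm
    have hPL := h.uniq P hP1 hP2
    rw [hPe] at hPL
    intro y z
    rw [hX', hX', hPL, add_sub_cancel_left, add_sub_cancel_left]
    exact hK2 y z
  have hcm : ∀ a y, m a y - L a y = m y a - L y a := fun a y => by rw [hc, h.comm]
  refine LinearMap.ext fun x => LinearMap.ext fun y => ?_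
  rw [hm0]
  refine sub_eq_zero.1 (ext_inner_right ℝ fun z => ?_)
  rw [inner_zero_left]
  have t1 := hsk x y z
  have t2 := hsk z x y
  have t3 := hsk y z x
  rw [real_inner_comm, hcm x z] at t1
  rw [real_inner_comm, hcm z y] at t2
  rw [real_inner_comm, hcm y x] at t3
  rw [real_inner_comm]
  linarith

lemma exists_good [Nontrivial E] (h : SD C) (hne : (interior C).Nonempty)
    (hhom : ∀ x ∈ interior C, ∀ y ∈ interior C, ∃ g ∈ Aut C, g x = y) :
    ∃ e ∈ interior C, ∃ m0, Good C e m0 ∧ ∀ m, Good C e m → m = m0 := by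
  obtain ⟨e, he, hk⟩ := skew_kill h hne
  obtain ⟨L, h1, h2, h3⟩ := exists_L h he hk (hhom e he)
  exact ⟨e, he, LD.good ⟨h, he, hk, fun x => (h1 x).1, fun x => (h1 x).2, h2,
    fun X hX hs => h3 X ⟨hX, hs⟩⟩⟩

/-- transport of structure -/
def tr (g : E ≃ₗ[ℝ] E) (m : E →ₗ[ℝ] E →ₗ[ℝ] E) : E →ₗ[ℝ] E →ₗ[ℝ] E :=
  (m.compl₁₂ (g.symm : E →ₗ[ℝ] E) (g.symm : E →ₗ[ℝ] E)).compr₂ (g : E →ₗ[ℝ] E)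

lemma tr_apply (g : E ≃ₗ[ℝ] E) (m : E →ₗ[ℝ] E →ₗ[ℝ] E) (a b : E) :
    tr g m a b = g (m (g.symm a) (g.symm b)) := rfl

lemma Good.tr {u : E} {m : E →ₗ[ℝ] E →ₗ[ℝ] E} (hm : Good C u m) (g : E ≃ₗ[ℝ] E)
    (hg : g '' C = C) : Good C (g u) (tr g m) := by
  obtain ⟨hc, hj, hu, hsq⟩ := hm
  refine ⟨fun a b => ?_, fun a b => ?_, fun a => ?_, ?_⟩
  · rw [tr_apply, tr_apply, hc]
  · simp only [tr_apply, LinearEquiv.symm_apply_apply]; rw [hj]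
  · simp only [tr_apply, LinearEquiv.symm_apply_apply]; rw [hu]; simp
  · ext y
    rw [← hg, ← hsq]
    constructor
    · rintro ⟨a, rfl⟩
      exact ⟨_, ⟨g.symm a, rfl⟩, rfl⟩
    · rintro ⟨_, ⟨a, rfl⟩, rfl⟩
      exact ⟨g a, by simp [tr_apply]⟩

lemma Good.real {u : E} {m : E →ₗ[ℝ] E →ₗ[ℝ] E} (h : SD C) (hm : Good C u m) (a b : E)
    (hab : m a a + m b b = 0) : a = 0 ∧ b = 0 := by
  obtain ⟨hc, hj, hu, hsq⟩ := hm
  have hC : ∀ a, m a a ∈ C := fun a => by rw [← hsq]; exact ⟨a, rfl⟩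
  have hlim : ∀ a, m a a = 0 → a ∈ C := by
    intro a ha
    have h1 : ∀ n : ℕ, (1 / ((n:ℝ) + 1)) • u + a ∈ C := by
      intro n
      have h2 := hC (u + (((n:ℝ) + 1) / 2) • a)
      simp only [map_add, map_smul, LinearMap.add_apply, LinearMap.smul_apply, ha, hu, hc a u,
        smul_zero, add_zero] at h2
      have h3 := h.smul (by positivity : 0 ≤ 1 / ((n:ℝ) + 1)) h2
      convert h3 using 1
      have : (n:ℝ) + 1 ≠ 0 := by positivity
      rw [add_assoc, ← add_smul, smul_add, smul_smul]
      congr 1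
      rw [add_halves, one_div_mul_cancel this, one_smul]
    have h4 : Filter.Tendsto (fun n : ℕ => (1 / ((n:ℝ) + 1)) • u + a) Filter.atTop
        (nhds ((0:ℝ) • u + a)) :=
      (tendsto_one_div_add_atTop_nhds_zero_nat.smul_const u).add_const a
    rw [zero_smul, zero_add] at h4
    exact h.closed.mem_of_tendsto h4 (Filter.Eventually.of_forall h1)
  have hz : ∀ a, m a a = 0 → a = 0 := fun a ha =>
    h.pointed (hlim a ha) (hlim (-a) (by simp [ha]))
  have h1 : m a a = 0 := h.pointed (hC a) (by
    rw [neg_eq_of_add_eq_zero_right hab]; exact hC b)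
  refine ⟨hz a h1, hz b ?_⟩
  rwa [h1, zero_add] at hab

end KV

/-- **Koecher–Vinberg.** A pointed, closed, convex, self-dual and homogeneous
cone `C` in a finite-dimensional real inner product space, with distinguished interior point
`u`, carries a unique commutative bilinear product satisfying the Jordan identity, with unit
`u` and with cone of squares `C`; moreover any such product is formally real.-/
theorem koecher_vinberg
    {E : Type*} [NormedAddCommGroup E] [InnerProductSpace ℝ E] [FiniteDimensional ℝ E]
    (C : Set E) (hclosed : IsClosed C) (hconv : Convex ℝ C)
    (hcone : ∀ t : ℝ, 0 < t → ∀ x ∈ C, t • x ∈ C)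
    (hpointed : C ∩ (-C) = {0})
    (hsd : C = {y : E | ∀ x ∈ C, 0 ≤ ⟪x, y⟫})
    (hhom : ∀ x ∈ interior C, ∀ y ∈ interior C,
      ∃ g : E ≃ₗ[ℝ] E, g '' C = C ∧ g x = y)
    (u : E) (hu : u ∈ interior C) :
    (∃! m : E →ₗ[ℝ] E →ₗ[ℝ] E,
      (∀ a b : E, m a b = m b a) ∧
      (∀ a b : E, m (m a a) (m a b) = m a (m (m a a) b)) ∧
      (∀ a : E, m u a = a) ∧
      {z : E | ∃ a : E, m a a = z} = C) ∧
    (∀ m : E →ₗ[ℝ] E →ₗ[ℝ] E,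
      (∀ a b : E, m a b = m b a) →
      (∀ a b : E, m (m a a) (m a b) = m a (m (m a a) b)) →
      (∀ a : E, m u a = a) →
      {z : E | ∃ a : E, m a a = z} = C →
      ∀ a b : E, m a a + m b b = 0 → a = 0 ∧ b = 0) := by
  have h : KV.SD C := ⟨fun y => by
    constructor
    · intro hy; rw [hsd] at hy; exact hy
    · intro hy; rw [hsd]; exact hy⟩
  refine ⟨?_, fun m h1 h2 h3 h4 => KV.Good.real h (u := u) ⟨h1, h2, h3, h4⟩⟩
  rcases subsingleton_or_nontrivial E with hE | hE
  · refine ⟨0, ⟨fun a b => Subsingleton.elim _ _, fun a b => Subsingleton.elim _ _,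
      fun a => Subsingleton.elim _ _, ?_⟩, fun m _ => ?_⟩
    · ext y
      have : y = 0 := Subsingleton.elim _ _
      subst this
      exact ⟨fun _ => h.zero, fun _ => ⟨0, by simp⟩⟩
    · exact LinearMap.ext fun x => LinearMap.ext fun y => Subsingleton.elim _ _
  have hsymm : ∀ g : E ≃ₗ[ℝ] E, g '' C = C → g.symm '' C = C := by
    intro g hg
    conv_lhs => rw [← hg]
    rw [← Set.image_comp]
    simp
  have hhom' : ∀ x ∈ interior C, ∀ y ∈ interior C, ∃ g ∈ KV.Aut C, g x = y := by
    intro x hx y hy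
    obtain ⟨g, hg, hgx⟩ := hhom x hx y hy
    refine ⟨LinearMap.toContinuousLinearMap (g : E →ₗ[ℝ] E), ⟨fun c hc => ?_,
      LinearMap.toContinuousLinearMap (g.symm : E →ₗ[ℝ] E), fun c hc => ?_, ?_, ?_⟩, hgx⟩
    · rw [← hg]; exact ⟨c, hc, rfl⟩
    · rw [← hsymm g hg]; exact ⟨c, hc, rfl⟩
    · ext c; simp
    · ext c; simp
  obtain ⟨e, he, m0, hm0, huniq⟩ := KV.exists_good h ⟨u, hu⟩ hhom'
  obtain ⟨g, hg, rfl⟩ := hhom e he u hu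
  refine ⟨KV.tr g m0, hm0.tr g hg, fun m hm => ?_⟩
  have hm' : KV.Good C (g e) m := hm
  have h1 := hm'.tr g.symm (hsymm g hg)
  rw [LinearEquiv.symm_apply_apply] at h1
  rw [← huniq _ h1]
  refine LinearMap.ext fun x => LinearMap.ext fun y => ?_
  simp [KV.tr_apply]
end

section
/- Let E be a finite-dimensional real vector space and C ⊆ E a closed, pointed, convex cone with nonempty interior, which is self-dual with respect to some inner product on E. Let G be a closed, connected subgroup of GL(E) such that every g ∈ G satisfies g(C) = C and G acts transitively on the interior of C, and let u be an interior point of C. Then there exists an inner product ⟨·,·⟩ on E that is self-dualizing for C (i.e., C = {y ∈ E : ⟨x,y⟩ ≥ 0 for all x ∈ C}) and such that for every g ∈ G: g u = u if and only if g is orthogonal with respect to ⟨·,·⟩ (i.e., ⟨g x, g y⟩ = ⟨x, y⟩ for all x, y ∈ E). In other words, the stabilizer G_u equals G ∩ O(E) for this inner product. -/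
namespace SDC
open MeasureTheory Set Filter Topology

set_option linter.unusedSectionVars false

section
variable {V : Type*} [NormedAddCommGroup V] [InnerProductSpace ℝ V] [FiniteDimensional ℝ V]

def SD (C : Set V) : Prop := ∀ y, y ∈ C ↔ ∀ x ∈ C, 0 ≤ inner ℝ x y

def Pres (C : Set V) (g : V ≃ₗ[ℝ] V) : Prop := ∀ x, g x ∈ C ↔ x ∈ C

lemma exists_adj (g : V ≃ₗ[ℝ] V) : ∃ g' : V ≃ₗ[ℝ] V, ∀ x y, inner ℝ (g x) y = inner ℝ x (g' y) := by
  refine ⟨LinearEquiv.ofLinearMap (LinearMap.adjoint (g : V →ₗ[ℝ] V))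
    (LinearMap.adjoint (g.symm : V →ₗ[ℝ] V)) ?_ ?_, ?_⟩
  · rw [← LinearMap.adjoint_comp]; simp
  · rw [← LinearMap.adjoint_comp]; simp
  · intro x y
    simp [LinearMap.adjoint_inner_right]

lemma Pres.adj {C : Set V} (hC : SD C) {g g' : V ≃ₗ[ℝ] V} (hg : Pres C g)
    (h : ∀ x y, inner ℝ (g x) y = inner ℝ x (g' y)) : Pres C g' := by
  intro y
  rw [hC, hC]
  constructor
  · intro H x hx
    have := H (g.symm x) (by rw [← hg]; simpa)
    rw [← h] at this
    simpa using this
  · intro H x hx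
    rw [← h]
    exact H _ ((hg x).2 hx)

lemma SD.add {C : Set V} (hC : SD C) {x y : V} (hx : x ∈ C) (hy : y ∈ C) : x + y ∈ C := by
  rw [hC]
  intro z hz
  rw [inner_add_right]
  exact add_nonneg ((hC x).1 hx z hz) ((hC y).1 hy z hz)

lemma SD.smul {C : Set V} (hC : SD C) {x : V} (hx : x ∈ C) {t : ℝ} (ht : 0 ≤ t) : t • x ∈ C := by
  rw [hC]
  intro z hz
  rw [inner_smul_right]
  exact mul_nonneg ht ((hC x).1 hx z hz)

lemma SD.closed {C : Set V} (hC : SD C) : IsClosed C := by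
  have : C = ⋂ x ∈ C, {y | 0 ≤ inner ℝ x y} := by
    ext y; rw [hC]; simp
  rw [this]
  refine isClosed_biInter fun x _ => ?_
  exact isClosed_le continuous_const (by fun_prop)

/-- uniform positivity at interior points -/
lemma SD.int_bound {C : Set V} (hC : SD C) {u : V} (hu : u ∈ interior C) :
    ∃ r > 0, Metric.closedBall u r ⊆ C ∧ ∀ y ∈ C, r * ‖y‖ ≤ inner ℝ u y := by
  obtain ⟨r, hr, hb⟩ := Metric.nhds_basis_closedBall.mem_iff.1 (mem_interior_iff_mem_nhds.1 hu)
  refine ⟨r, hr, hb, fun y hy => ?_⟩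
  rcases eq_or_ne y 0 with rfl | h0
  · simp
  have hn : 0 < ‖y‖ := norm_pos_iff.2 h0
  have hm : u - (r / ‖y‖) • y ∈ C := by
    apply hb
    simp only [Metric.mem_closedBall, dist_eq_norm]
    rw [show u - (r / ‖y‖) • y - u = -((r / ‖y‖) • y) by abel, norm_neg, norm_smul,
      Real.norm_of_nonneg (by positivity)]
    field_simp; rfl
  have := (hC y).1 hy _ hm
  rw [inner_sub_left, inner_smul_left, real_inner_self_eq_norm_sq] at this
  simp only [conj_trivial] at this
  have e : r / ‖y‖ * ‖y‖ ^ 2 = r * ‖y‖ := by field_simp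
  linarith

lemma SD.mem_int {C : Set V} (hC : SD C) {x : V}
    (h : ∀ y ∈ C, y ≠ 0 → 0 < inner ℝ x y) : x ∈ interior C := by
  have hk : IsCompact (C ∩ Metric.sphere (0 : V) 1) :=
    (isCompact_sphere _ _).inter_left hC.closed
  obtain ⟨d, hd, hb⟩ := hk.exists_forall_le' (f := fun y => inner ℝ x y) (a := 0)
    (by fun_prop) (by
      rintro y ⟨hy, hs⟩
      exact h y hy (by rintro rfl; simp at hs))
  rw [mem_interior_iff_mem_nhds]
  refine Filter.mem_of_superset (Metric.closedBall_mem_nhds x hd) fun z hz => ?_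
  rw [hC]
  intro y hy
  rcases eq_or_ne y 0 with rfl | h0
  · simp
  have hn : 0 < ‖y‖ := norm_pos_iff.2 h0
  have h1 := hb (‖y‖⁻¹ • y) ⟨hC.smul hy (by positivity), by simp [norm_smul, hn.ne']⟩
  simp only [inner_smul_right] at h1
  have h2 : d * ‖y‖ ≤ inner ℝ x y := by
    rw [inv_mul_eq_div, le_div_iff₀ hn] at h1; exact h1
  have h3 : |inner ℝ (z - x) y| ≤ d * ‖y‖ := by
    refine (abs_real_inner_le_norm _ _).trans ?_
    gcongr
    simpa [dist_eq_norm] using hz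
  rw [real_inner_comm, show z = x + (z - x) by abel, inner_add_left]
  linarith [neg_abs_le (inner ℝ (z - x) y)]

variable [MeasurableSpace V] [BorelSpace V]

noncomputable def phi (C : Set V) (x : V) : ENNReal :=
  ∫⁻ y in C, ENNReal.ofReal (Real.exp (-inner ℝ x y))

lemma phi_comp {C : Set V} (hC : SD C) {g g' : V ≃ₗ[ℝ] V} (hg' : Pres C g')
    (h : ∀ x y, inner ℝ (g x) y = inner ℝ x (g' y)) {c : ENNReal}
    (hc : Measure.map g' (volume : Measure V) = c • volume) (x : V) :
    phi C (g x) = c * phi C x := by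
  have hme : Measurable g' := (LinearMap.continuous_of_finiteDimensional (g' : V →ₗ[ℝ] V)).measurable
  have hpre : g' ⁻¹' C = C := by ext y; exact hg' y
  have hmC : MeasurableSet C := hC.closed.measurableSet
  unfold phi
  simp only [h]
  rw [← smul_eq_mul, ← lintegral_smul_measure, ← Measure.restrict_smul, ← hc, Measure.restrict_map hme hmC, hpre,
    lintegral_map (by fun_prop) hme]

lemma phi_finite {C : Set V} (hC : SD C) {u : V} (hu : u ∈ interior C) : phi C u ≠ ⊤ := by
  obtain ⟨r, hr, -, hb⟩ := hC.int_bound hu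
  set n := Module.finrank ℝ V
  obtain ⟨K, hK, hKb⟩ : ∃ K : ℝ, 0 < K ∧ ∀ t : ℝ, 0 ≤ t → Real.exp (-(r * t)) ≤ K * (1 + t) ^ (-((n : ℝ) + 1)) := by
    refine ⟨Real.exp r * (n+1).factorial / r ^ (n+1), by positivity, fun t ht => ?_⟩
    have h1 := Real.pow_div_factorial_le_exp (r * (1 + t)) (by positivity) (n+1)
    have h2 : (1 + t) ^ (-((n : ℝ) + 1)) = ((1+t)^(n+1))⁻¹ := by
      rw [Real.rpow_neg (by positivity)]
      congr 1
      exact_mod_cast Real.rpow_natCast (1+t) (n+1)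
    rw [h2, Real.exp_neg]
    have h4 : Real.exp (r * (1 + t)) = Real.exp r * Real.exp (r * t) := by
      rw [← Real.exp_add]; ring_nf
    rw [h4, mul_pow, div_le_iff₀ (by positivity)] at h1
    have : Real.exp r * ↑(n + 1).factorial / r ^ (n + 1) * ((1 + t) ^ (n + 1))⁻¹
      = Real.exp r * ↑(n + 1).factorial / (r ^ (n + 1) * ((1 + t) ^ (n + 1))) := by
        field_simp
    rw [this, inv_eq_one_div, div_le_div_iff₀ (by positivity) (by positivity)]
    linarith
  have hi : Integrable (fun y : V => K * (1 + ‖y‖) ^ (-((n : ℝ) + 1))) volume :=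
    (integrable_one_add_norm (by simp [n])).const_mul K
  have hfin := hi.lintegral_lt_top
  refine ne_top_of_le_ne_top hfin.ne ?_
  unfold phi
  refine le_trans (setLIntegral_mono' hC.closed.measurableSet fun y hy => ?_) (setLIntegral_le_lintegral C _)
  apply ENNReal.ofReal_le_ofReal
  refine le_trans ?_ (hKb ‖y‖ (norm_nonneg _))
  exact Real.exp_le_exp.2 (neg_le_neg (hb y hy))

lemma phi_pos {C : Set V} (hint : (interior C).Nonempty) (x : V) : phi C x ≠ 0 := by
  unfold phi
  intro h
  rw [lintegral_eq_zero_iff (by fun_prop)] at h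
  have h2 : ∀ᵐ y ∂(volume.restrict C), False := by
    filter_upwards [h] with y hy
    simp at hy
    linarith [Real.exp_pos (-inner ℝ x y)]
  have h0 : volume C = 0 := by
    simpa using h2
  exact (isOpen_interior.measure_pos volume hint).ne' (measure_mono_null interior_subset h0)

lemma mem_int_of_phi {C : Set V} (hC : SD C) (hp : ∀ x ∈ C, -x ∈ C → x = 0)
    (hint : (interior C).Nonempty) {x : V} (hx : x ∈ C) (hf : phi C x ≠ ⊤) :
    x ∈ interior C := by
  refine hC.mem_int fun y0 hy0 h0 => ?_
  refine lt_of_le_of_ne ((hC _).1 hy0 x hx) fun hz => ?_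
  have hmC : MeasurableSet C := hC.closed.measurableSet
  set D : Set V := (fun y => y - y0) ⁻¹' C with hD
  have hDC : D ⊆ C := fun y hy => by
    have := hC.add hy hy0
    simpa using this
  have hmD : MeasurableSet D := hmC.preimage (by fun_prop)
  have e1 : phi C x = ∫⁻ y in D, ENNReal.ofReal (Real.exp (-inner ℝ x y)) := by
    unfold phi
    rw [← lintegral_indicator hmC, ← lintegral_indicator hmD,
      ← lintegral_sub_right_eq_self _ y0]
    congr 1; ext y
    by_cases hy : y - y0 ∈ C
    · rw [indicator_of_mem hy, indicator_of_mem (show y ∈ D from hy), inner_sub_right, ← hz, sub_zero]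
    · rw [indicator_of_notMem hy, indicator_of_notMem (show y ∉ D from hy)]
  have e2 : phi C x = (∫⁻ y in D, ENNReal.ofReal (Real.exp (-inner ℝ x y))) +
      ∫⁻ y in C \ D, ENNReal.ofReal (Real.exp (-inner ℝ x y)) := by
    unfold phi
    rw [← lintegral_union (hmC.diff hmD) disjoint_sdiff_right, union_sdiff_cancel hDC]
  rw [← e1] at e2
  have e3 : ∫⁻ y in C \ D, ENNReal.ofReal (Real.exp (-inner ℝ x y)) = 0 := by
    have : phi C x + 0 = phi C x + ∫⁻ y in C \ D, ENNReal.ofReal (Real.exp (-inner ℝ x y)) := by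
      rw [add_zero]; exact e2
    exact ((ENNReal.add_right_inj hf).1 this).symm
  refine phi_pos (C := C \ D) ?_ x e3
  obtain ⟨c, hc⟩ := hint
  have hDcl : IsClosed D := hC.closed.preimage (by fun_prop)
  have hex : ∃ n : ℕ, (1 / ((n : ℝ) + 1)) • c ∉ D := by
    by_contra! hcon
    have hl : Tendsto (fun n : ℕ => (1 / ((n : ℝ) + 1)) • c) atTop (𝓝 ((0 : ℝ) • c)) :=
      tendsto_one_div_add_atTop_nhds_zero_nat.smul_const c
    have := hDcl.mem_of_tendsto hl (Eventually.of_forall hcon)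
    rw [zero_smul] at this
    exact h0 (hp _ hy0 (by simpa [hD] using this))
  obtain ⟨n, hn⟩ := hex
  refine ⟨(1 / ((n : ℝ) + 1)) • c, ?_⟩
  rw [mem_interior_iff_mem_nhds, sdiff_eq]
  refine inter_mem ?_ (hDcl.isOpen_compl.mem_nhds hn)
  rw [← mem_interior_iff_mem_nhds]
  apply hC.mem_int
  intro y hy hy0
  obtain ⟨r, hr, -, hb⟩ := hC.int_bound hc
  have := hb y hy
  have h3 : 0 < r * ‖y‖ := mul_pos hr (norm_pos_iff.2 hy0)
  rw [real_inner_smul_left]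
  exact mul_pos (by positivity) (by linarith)

lemma phi_lsc (C : Set V) : LowerSemicontinuous (phi C) := by
  intro x a ha
  by_contra hcon
  rw [Filter.not_eventually] at hcon
  obtain ⟨s, hs, hs2⟩ := Filter.exists_seq_forall_of_frequently (l := 𝓝 x) hcon
  have hf := lintegral_liminf_le (μ := volume.restrict C) (u := atTop)
    (f := fun n y => ENNReal.ofReal (Real.exp (-inner ℝ (s n) y))) (fun n => by fun_prop)
  have h1 : (∫⁻ y in C, liminf (fun n => ENNReal.ofReal (Real.exp (-inner ℝ (s n) y))) atTop) = phi C x := by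
    unfold phi
    congr 1; ext y
    apply Tendsto.liminf_eq
    have : Continuous fun x : V => ENNReal.ofReal (Real.exp (-inner ℝ x y)) :=
      ENNReal.continuous_ofReal.comp (by fun_prop)
    exact (this.tendsto x).comp hs
  rw [h1] at hf
  have h2 : liminf (fun n => phi C (s n)) atTop ≤ a := by
    refine liminf_le_of_frequently_le' (Frequently.of_forall fun n => ?_)
    exact not_lt.1 (hs2 n)
  exact absurd (hf.trans h2) (not_le.2 ha)

lemma phi_convex (C : Set V) (x y : V) {t : ℝ} (h0 : 0 ≤ t) (h1 : t ≤ 1) :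
    phi C ((1 - t) • x + t • y) ≤ ENNReal.ofReal (1 - t) * phi C x + ENNReal.ofReal t * phi C y := by
  unfold phi
  rw [← lintegral_const_mul _ (by fun_prop), ← lintegral_const_mul _ (by fun_prop),
    ← lintegral_add_left (by fun_prop)]
  refine lintegral_mono fun z => ?_
  simp only
  rw [← ENNReal.ofReal_mul (by linarith), ← ENNReal.ofReal_mul h0, ← ENNReal.ofReal_add
    (mul_nonneg (by linarith) (Real.exp_pos _).le) (mul_nonneg h0 (Real.exp_pos _).le)]
  apply ENNReal.ofReal_le_ofReal
  have := convexOn_exp.2 (mem_univ (-inner ℝ x z)) (mem_univ (-inner ℝ y z))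
    (show 0 ≤ 1 - t by linarith) h0 (by ring)
  simp only [smul_eq_mul] at this
  refine le_trans (le_of_eq ?_) this
  congr 1
  rw [inner_add_left, real_inner_smul_left, real_inner_smul_left]; ring

lemma phi_strict {C : Set V} (hint : (interior C).Nonempty) {x y : V} (hxy : x ≠ y)
    (hx : phi C x ≠ ⊤) (hy : phi C y ≠ ⊤) :
    2 * phi C ((1/2 : ℝ) • (x + y)) < phi C x + phi C y := by
  have key : phi C x + phi C y = 2 * phi C ((1/2 : ℝ) • (x + y)) +
      ∫⁻ z in C, ENNReal.ofReal ((Real.exp (-inner ℝ x z / 2) - Real.exp (-inner ℝ y z / 2)) ^ 2) := by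
    unfold phi
    rw [← lintegral_add_left (by fun_prop), ← lintegral_const_mul _ (by fun_prop),
      ← lintegral_add_left (by fun_prop)]
    congr 1; ext z
    rw [← ENNReal.ofReal_add (by positivity) (by positivity),
      show (2 : ENNReal) = ENNReal.ofReal 2 by simp, ← ENNReal.ofReal_mul (by norm_num),
      ← ENNReal.ofReal_add (by positivity) (by positivity)]
    congr 1
    rw [real_inner_smul_left, inner_add_left, sub_sq, ← Real.exp_nat_mul, ← Real.exp_nat_mul,
      mul_assoc 2 (Real.exp _), ← Real.exp_add]
    rw [show -(1 / 2 * (inner ℝ x z + inner ℝ y z)) = -inner ℝ x z / 2 + -inner ℝ y z / 2 by ring]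
    rw [show ((2 : ℕ) : ℝ) * (-inner ℝ x z / 2) = -inner ℝ x z by push_cast; ring,
      show ((2 : ℕ) : ℝ) * (-inner ℝ y z / 2) = -inner ℝ y z by push_cast; ring]
    ring
  have hne : ∫⁻ z in C, ENNReal.ofReal ((Real.exp (-inner ℝ x z / 2) - Real.exp (-inner ℝ y z / 2)) ^ 2) ≠ 0 := by
    intro h
    rw [lintegral_eq_zero_iff (by fun_prop)] at h
    have hU : (fun z => inner ℝ x z) =ᵐ[volume.restrict (interior C)] fun z => inner ℝ y z := by
      filter_upwards [ae_restrict_of_ae_restrict_of_subset interior_subset h] with z hz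
      simp only [Pi.zero_apply, ENNReal.ofReal_eq_zero] at hz
      have h0 : Real.exp (-inner ℝ x z / 2) - Real.exp (-inner ℝ y z / 2) = 0 := by
        have := le_antisymm hz (sq_nonneg _)
        exact pow_eq_zero_iff (by norm_num) |>.1 this
      have := Real.exp_injective (sub_eq_zero.1 h0)
      linarith
    have hE := Measure.eqOn_open_of_ae_eq hU isOpen_interior (by fun_prop) (by fun_prop)
    obtain ⟨c, hc⟩ := hint
    obtain ⟨r, hr, hb⟩ := Metric.isOpen_iff.1 isOpen_interior c hc
    set w := x - y
    have hw : 0 < ‖w‖ := norm_pos_iff.2 (sub_ne_zero.2 hxy)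
    have hm : c + (r / 2 / ‖w‖) • w ∈ interior C := by
      apply hb
      simp only [Metric.mem_ball, dist_eq_norm, add_sub_cancel_left, norm_smul]
      rw [Real.norm_of_nonneg (by positivity)]
      field_simp; linarith
    have a1 := hE hc
    have a2 := hE hm
    simp only [inner_add_right, real_inner_smul_right] at a1 a2
    have a3 : (r / 2 / ‖w‖) * inner ℝ w w = 0 := by
      conv_lhs => rw [show inner ℝ w w = inner ℝ (x - y) w from rfl, inner_sub_left]
      linarith
    rw [real_inner_self_eq_norm_sq] at a3
    have : 0 < r / 2 / ‖w‖ * ‖w‖ ^ 2 := by positivity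
    linarith
  have hmid : 2 * phi C ((1/2 : ℝ) • (x + y)) ≠ ⊤ := by
    refine ne_top_of_le_ne_top (ENNReal.add_ne_top.2 ⟨hx, hy⟩) ?_
    rw [key]; exact le_self_add
  rw [key]
  exact ENNReal.lt_add_right hmid hne


lemma exists_min {C : Set V} (hC : SD C) (hint : (interior C).Nonempty) :
    ∃ e ∈ C, phi C e ≠ ⊤ ∧ ∀ x ∈ C, phi C e + ENNReal.ofReal (‖e‖ ^ 2 / 2) ≤
      phi C x + ENNReal.ofReal (‖x‖ ^ 2 / 2) := by
  obtain ⟨x0, hx0⟩ := hint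
  have hf := phi_finite hC hx0
  set F : V → ENNReal := fun x => phi C x + ENNReal.ofReal (‖x‖ ^ 2 / 2) with hF
  have hF0 : F x0 ≠ ⊤ := ENNReal.add_ne_top.2 ⟨hf, ENNReal.ofReal_ne_top⟩
  set M := (F x0).toReal with hM
  have hM0 : 0 ≤ M := ENNReal.toReal_nonneg
  have hout : ∀ x, Real.sqrt (2 * M) < ‖x‖ → F x0 ≤ F x := by
    intro x hx
    have h1 : 2 * M ≤ ‖x‖ ^ 2 := (Real.sqrt_le_left (norm_nonneg _)).1 hx.le
    calc F x0 = ENNReal.ofReal M := (ENNReal.ofReal_toReal hF0).symm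
      _ ≤ ENNReal.ofReal (‖x‖ ^ 2 / 2) := ENNReal.ofReal_le_ofReal (by linarith)
      _ ≤ F x := le_add_self
  have hlsc : LowerSemicontinuous F := by
    apply (phi_lsc C).add
    exact (ENNReal.continuous_ofReal.comp (by fun_prop)).lowerSemicontinuous
  have hk : IsCompact (C ∩ Metric.closedBall (0 : V) (Real.sqrt (2 * M))) :=
    (isCompact_closedBall _ _).inter_left hC.closed
  have hx0m : x0 ∈ C ∩ Metric.closedBall (0 : V) (Real.sqrt (2 * M)) := by
    refine ⟨interior_subset hx0, ?_⟩
    rw [mem_closedBall_zero_iff]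
    apply Real.le_sqrt_of_sq_le
    have : ENNReal.ofReal (‖x0‖ ^ 2 / 2) ≤ F x0 := le_add_self
    rw [← ENNReal.ofReal_toReal hF0, ENNReal.ofReal_le_ofReal_iff hM0] at this
    linarith
  obtain ⟨e, he, hmin⟩ := LowerSemicontinuousOn.exists_isMinOn ⟨x0, hx0m⟩ hk
    (hlsc.lowerSemicontinuousOn _)
  have hall : ∀ x ∈ C, F e ≤ F x := by
    intro x hx
    by_cases hb : ‖x‖ ≤ Real.sqrt (2 * M)
    · exact hmin ⟨hx, by simpa using hb⟩
    · exact (hmin hx0m).trans (hout x (not_le.1 hb))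
  refine ⟨e, he.1, ?_, hall⟩
  exact (ENNReal.add_ne_top.1 (ne_top_of_le_ne_top hF0 (hmin hx0m))).1

lemma core_step {C : Set V} (hC : SD C) (hint : (interior C).Nonempty) :
    ∃ e ∈ C, phi C e ≠ ⊤ ∧ ∀ x ∈ C, phi C x = phi C e → inner ℝ e x ≤ inner ℝ e e → x = e := by
  obtain ⟨e, he, hfe, hmin⟩ := exists_min hC hint
  refine ⟨e, he, hfe, ?_⟩
  set f : V → ℝ := fun x => (phi C x).toReal with hf
  have hmin' : ∀ x ∈ C, phi C x ≠ ⊤ → f e + ‖e‖ ^ 2 / 2 ≤ f x + ‖x‖ ^ 2 / 2 := by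
    intro x hx hfx
    have := hmin x hx
    rw [← ENNReal.ofReal_toReal hfe, ← ENNReal.ofReal_toReal hfx,
      ← ENNReal.ofReal_add ENNReal.toReal_nonneg (by positivity),
      ← ENNReal.ofReal_add ENNReal.toReal_nonneg (by positivity)] at this
    rwa [ENNReal.ofReal_le_ofReal_iff (add_nonneg ENNReal.toReal_nonneg (by positivity))] at this
  have hsub : ∀ x ∈ C, phi C x ≠ ⊤ → f e + inner ℝ e e ≤ f x + inner ℝ e x := by
    intro x hx hfx
    by_contra! hlt
    set d := f e + inner ℝ e e - (f x + inner ℝ e x) with hd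
    have hd0 : 0 < d := by linarith
    have hineq : ∀ t : ℝ, 0 < t → t ≤ 1 → d ≤ t * (‖x - e‖ ^ 2 / 2) := by
      intro t ht ht1
      have hc := phi_convex C e x ht.le ht1
      have hnt : ENNReal.ofReal (1 - t) * phi C e + ENNReal.ofReal t * phi C x ≠ ⊤ :=
        ENNReal.add_ne_top.2 ⟨ENNReal.mul_ne_top ENNReal.ofReal_ne_top hfe,
          ENNReal.mul_ne_top ENNReal.ofReal_ne_top hfx⟩
      have hfm := ne_top_of_le_ne_top hnt hc
      have hc' := ENNReal.toReal_mono hnt hc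
      rw [ENNReal.toReal_add (ENNReal.mul_ne_top ENNReal.ofReal_ne_top hfe)
          (ENNReal.mul_ne_top ENNReal.ofReal_ne_top hfx), ENNReal.toReal_mul, ENNReal.toReal_mul,
          ENNReal.toReal_ofReal (by linarith), ENNReal.toReal_ofReal ht.le] at hc'
      have h1 := hmin' _ (hC.add (hC.smul he (t := 1 - t) (by linarith)) (hC.smul hx ht.le)) hfm
      have h2 : ‖(1 - t) • e + t • x‖ ^ 2 = ‖e‖ ^ 2 + 2 * t * (inner ℝ e x - inner ℝ e e)
          + t ^ 2 * ‖x - e‖ ^ 2 := by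
        rw [show (1 - t) • e + t • x = e + t • (x - e) by module, norm_add_sq_real,
          real_inner_smul_right, inner_sub_right, norm_smul, mul_pow, Real.norm_eq_abs, sq_abs]
        ring
      have h3 : t * d ≤ t * (t * (‖x - e‖ ^ 2 / 2)) := by
        simp only [hf] at h1 hd
        rw [h2] at h1
        rw [hd]
        nlinarith
      exact le_of_mul_le_mul_left h3 ht
    set A := ‖x - e‖ ^ 2 / 2 with hA
    have hA0 : 0 ≤ A := by positivity
    have h5 := hineq (min 1 (d / (2 * (A + 1)))) (lt_min one_pos (by positivity)) (min_le_left _ _)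
    have h6 : min 1 (d / (2 * (A + 1))) * A ≤ d / (2 * (A + 1)) * A := by
      gcongr; exact min_le_right _ _
    have h7 : d / (2 * (A + 1)) * A ≤ d / 2 := by
      rw [div_mul_eq_mul_div, div_le_div_iff₀ (by positivity) (by positivity)]
      nlinarith
    linarith
  intro x hx hfx hle
  by_contra hne
  have hfx' : phi C x ≠ ⊤ := by rw [hfx]; exact hfe
  have hs := phi_strict hint hne hfx' hfe
  have htop : phi C x + phi C e ≠ ⊤ := ENNReal.add_ne_top.2 ⟨hfx', hfe⟩
  have hm := (ENNReal.toReal_lt_toReal (ne_top_of_lt hs) htop).2 hs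
  rw [ENNReal.toReal_add hfx' hfe, ENNReal.toReal_mul, hfx] at hm
  have hmt : phi C ((1/2 : ℝ) • (x + e)) ≠ ⊤ := by
    intro h
    rw [h] at hs
    simp at hs
  have h1 := hsub ((1/2 : ℝ) • (x + e)) (hC.smul (hC.add hx he) (by norm_num)) hmt
  rw [real_inner_smul_right, inner_add_right] at h1
  simp only [hf] at h1
  have h2 : ENNReal.toReal 2 = 2 := by simp
  rw [h2] at hm
  linarith

lemma contract {C : Set V} (hC : SD C) {e : V} (he : e ∈ interior C)
    (hadj : ∀ g g' : V ≃ₗ[ℝ] V, Pres C g → (∀ x y, inner ℝ (g x) y = inner ℝ x (g' y)) →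
      g e = e → g' e = e)
    (g : V ≃ₗ[ℝ] V) (hg : Pres C g) (hge : g e = e) (x : V) : ‖g x‖ ≤ ‖x‖ := by
  obtain ⟨r, hr, hball, hb⟩ := hC.int_bound he
  obtain ⟨M, hM0, hM⟩ : ∃ M : ℝ, 0 ≤ M ∧ ∀ h : V ≃ₗ[ℝ] V, Pres C h → h e = e → ∀ x, ‖x‖ ≤ r → ‖h x‖ ≤ M := by
    refine ⟨(‖e‖ * r + ‖e‖ ^ 2) / r + ‖e‖, by positivity, fun h hh hhe x hx => ?_⟩
    obtain ⟨h', hh'⟩ := exists_adj h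
    have h1 : e + x ∈ C := hball (by simpa [dist_eq_norm] using hx)
    have h2 := hb _ ((hh _).2 h1)
    rw [map_add, hhe, inner_add_right, real_inner_comm (h x) e, hh', hadj h h' hh hh' hhe,
      real_inner_self_eq_norm_sq] at h2
    have h3 : inner ℝ x e ≤ ‖e‖ * r := by
      refine (real_inner_le_norm _ _).trans ?_
      rw [mul_comm]; gcongr
    have h4 : ‖e + h x‖ ≤ (‖e‖ * r + ‖e‖ ^ 2) / r := by
      rw [le_div_iff₀ hr]; linarith
    have h5 : ‖h x‖ ≤ ‖e + h x‖ + ‖e‖ := by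
      have := norm_sub_le (e + h x) e
      simpa using this
    linarith
  have hK : ∀ h : V ≃ₗ[ℝ] V, Pres C h → h e = e → ∀ x, ‖h x‖ ≤ M / r * ‖x‖ := by
    intro h hh hhe x
    rcases eq_or_ne x 0 with rfl | h0
    · simp
    have hn : 0 < ‖x‖ := norm_pos_iff.2 h0
    have := hM h hh hhe ((r / ‖x‖) • x) (by
      rw [norm_smul, Real.norm_of_nonneg (by positivity)]; field_simp; rfl)
    rw [map_smul, norm_smul, Real.norm_of_nonneg (by positivity)] at this
    rw [div_mul_eq_mul_div, le_div_iff₀ hr]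
    rw [div_mul_eq_mul_div, div_le_iff₀ hn] at this
    linarith
  set K := M / r
  have hpow : ∀ n : ℕ, ∀ h : V ≃ₗ[ℝ] V, Pres C h → h e = e → ∀ x, ‖h x‖ ^ (2 ^ n) ≤ K * ‖x‖ ^ (2 ^ n) := by
    intro n
    induction n with
    | zero => simpa using hK
    | succ n ih =>
      intro h hh hhe x
      obtain ⟨h', hh'⟩ := exists_adj h
      have hP : Pres C (h.trans h') := fun y => by
        simp only [LinearEquiv.trans_apply]
        rw [hh.adj hC hh', hh]
      have h1 := ih (h.trans h') hP (by
        simp only [LinearEquiv.trans_apply]; rw [hhe, hadj h h' hh hh' hhe]) x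
      have h2 : ‖h x‖ ^ 2 ≤ ‖x‖ * ‖(h.trans h') x‖ := by
        rw [← real_inner_self_eq_norm_sq, hh']
        exact real_inner_le_norm _ _
      calc ‖h x‖ ^ (2 ^ (n+1)) = (‖h x‖ ^ 2) ^ (2 ^ n) := by rw [← pow_mul]; ring_nf
        _ ≤ (‖x‖ * ‖(h.trans h') x‖) ^ (2 ^ n) := by gcongr
        _ = ‖x‖ ^ (2 ^ n) * ‖(h.trans h') x‖ ^ (2 ^ n) := mul_pow _ _ _
        _ ≤ ‖x‖ ^ (2 ^ n) * (K * ‖x‖ ^ (2 ^ n)) := by gcongr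
        _ = K * ‖x‖ ^ (2 ^ (n+1)) := by rw [pow_succ 2 n, pow_mul]; ring
  rcases eq_or_ne x 0 with rfl | h0
  · simp
  have hn : 0 < ‖x‖ := norm_pos_iff.2 h0
  by_contra! hlt
  have hq : 1 < ‖g x‖ / ‖x‖ := by rwa [one_lt_div hn]
  obtain ⟨m, hm⟩ := pow_unbounded_of_one_lt K hq
  have h1 : (‖g x‖ / ‖x‖) ^ m ≤ (‖g x‖ / ‖x‖) ^ (2 ^ m) :=
    pow_le_pow_right₀ hq.le Nat.lt_two_pow_self.le
  have h2 := hpow m g hg hge x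
  rw [div_pow, div_pow, ← div_pow] at h1
  rw [← div_le_iff₀ (by positivity)] at h2
  linarith

theorem core {C : Set V} (hC : SD C) (hp : ∀ x ∈ C, -x ∈ C → x = 0)
    (hint : (interior C).Nonempty) :
    ∃ e ∈ interior C, ∀ g : V ≃ₗ[ℝ] V, Pres C g →
      (g e = e ↔ ∀ x y, inner ℝ (g x) (g y) = inner ℝ x y) := by
  obtain ⟨e, he, hfe, huniq⟩ := core_step hC hint
  have hei := mem_int_of_phi hC hp hint he hfe
  refine ⟨e, hei, fun g hg => ?_⟩
  have hadj : ∀ g g' : V ≃ₗ[ℝ] V, Pres C g → (∀ x y, inner ℝ (g x) y = inner ℝ x (g' y)) →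
      g e = e → g' e = e := by
    intro g g' hg h hge
    have hg' := hg.adj hC h
    have h' : ∀ x y, inner ℝ (g' x) y = inner ℝ x (g y) := fun x y => by
      rw [real_inner_comm, ← h, real_inner_comm]
    have hdet : LinearMap.det (g' : V →ₗ[ℝ] V) = LinearMap.det (g : V →ₗ[ℝ] V) := by
      have : (g' : V →ₗ[ℝ] V) = LinearMap.adjoint (g : V →ₗ[ℝ] V) :=
        (LinearMap.eq_adjoint_iff _ _).2 h'
      let bs := stdOrthonormalBasis ℝ V
      rw [this, ← LinearMap.det_toMatrix bs.toBasis, LinearMap.toMatrix_adjoint,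
        Matrix.det_conjTranspose, LinearMap.det_toMatrix]
      simp
    have m1 := Measure.map_linearMap_addHaar_eq_smul_addHaar (volume : Measure V)
      (f := (g : V →ₗ[ℝ] V)) (LinearEquiv.isUnit_det' g).ne_zero
    have m2 := Measure.map_linearMap_addHaar_eq_smul_addHaar (volume : Measure V)
      (f := (g' : V →ₗ[ℝ] V)) (LinearEquiv.isUnit_det' g').ne_zero
    rw [hdet] at m2
    have p1 := phi_comp hC hg' h m2 e
    have p2 := phi_comp hC hg h' m1 e
    rw [← p1, hge] at p2
    refine huniq _ ((hg' e).2 he) p2 ?_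
    rw [← h, hge]
  constructor
  · intro hge
    have hnorm : ∀ x, ‖g x‖ = ‖x‖ := by
      intro x
      refine le_antisymm (contract hC hei hadj g hg hge x) ?_
      have := contract hC hei hadj g.symm (fun y => by rw [← hg]; simp)
        (by rw [LinearEquiv.symm_apply_eq, hge]) (g x)
      simpa using this
    intro x y
    exact LinearIsometryEquiv.inner_map_map (⟨g, hnorm⟩ : V ≃ₗᵢ[ℝ] V) x y
  · intro hiso
    have hnorm : ∀ x, ‖g x‖ = ‖x‖ := fun x => by
      have := hiso x x
      rw [real_inner_self_eq_norm_sq, real_inner_self_eq_norm_sq] at this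
      exact (sq_eq_sq₀ (norm_nonneg _) (norm_nonneg _)).1 this
    have hsymm : Pres C g.symm := fun y => by rw [← hg]; simp
    have h : ∀ x y, inner ℝ (g x) y = inner ℝ x (g.symm y) := fun x y => by
      rw [← hiso x]; simp
    let L : V ≃ₗᵢ[ℝ] V := ⟨g, hnorm⟩
    have hm : Measure.map g.symm (volume : Measure V) = (1 : ENNReal) • volume := by
      rw [one_smul]
      exact L.symm.measurePreserving.map_eq
    have p := phi_comp hC hsymm h hm e
    rw [one_mul] at p
    refine huniq _ ((hg e).2 he) p ?_
    refine (real_inner_le_norm _ _).trans ?_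
    rw [hnorm, real_inner_self_eq_norm_sq, sq]

end

lemma exists_iso {E : Type*} [AddCommGroup E] [Module ℝ E] [FiniteDimensional ℝ E]
    (B : E →ₗ[ℝ] E →ₗ[ℝ] ℝ) (hs : ∀ x y, B x y = B y x) (hpos : ∀ x, x ≠ 0 → 0 < B x x) :
    ∃ T : E ≃ₗ[ℝ] EuclideanSpace ℝ (Fin (Module.finrank ℝ E)),
      ∀ x y, B x y = inner ℝ (T x) (T y) := by
  let c : InnerProductSpace.Core ℝ E :=
    { inner := fun x y => B x y
      conj_inner_symm := fun x y => by simpa using hs y x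
      re_inner_nonneg := fun x => by
        rcases eq_or_ne x 0 with rfl | h
        · simp
        · simpa using (hpos x h).le
      add_left := fun x y z => by simp
      smul_left := fun x y r => by simp
      definite := fun x h => by
        by_contra hx
        exact (hpos x hx).ne' h }
  let _ : NormedAddCommGroup E := c.toNormedAddCommGroup
  let _ : InnerProductSpace ℝ E := InnerProductSpace.ofCore c.toCore
  refine ⟨(stdOrthonormalBasis ℝ E).repr.toLinearEquiv, fun x y => ?_⟩
  have := (stdOrthonormalBasis ℝ E).repr.inner_map_map x y
  exact this.symm

end SDC

/-- Let `C` be a proper cone in a finite-dimensional real vector space,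
self-dual with respect to some inner product, and let `G` be a closed connected subgroup of
`GL(E)` preserving `C` and acting transitively on its interior.  For any interior point `u`
of `C`, there is a self-dualizing inner product for `C` such that an element `g ∈ G` fixes
`u` exactly when `g` is orthogonal for that inner product, i.e. `G_u = G ∩ O(E)`. -/
theorem exists_selfDualizing_inner_with_stabilizer_orthogonal
    {E : Type*} [NormedAddCommGroup E] [NormedSpace ℝ E] [FiniteDimensional ℝ E]
    (C : Set E) (hclosed : IsClosed C) (hconv : Convex ℝ C)
    (hcone : ∀ t : ℝ, 0 < t → ∀ x ∈ C, t • x ∈ C)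
    (hpointed : C ∩ (-C) = {0})
    (hint : (interior C).Nonempty)
    -- `C` is self-dual with respect to some inner product
    (hsd : ∃ B₀ : E →ₗ[ℝ] E →ₗ[ℝ] ℝ,
      (∀ x y : E, B₀ x y = B₀ y x) ∧ (∀ x : E, x ≠ 0 → 0 < B₀ x x) ∧
      C = {y : E | ∀ x ∈ C, 0 ≤ B₀ x y})
    (G : Subgroup (E →L[ℝ] E)ˣ)
    (hGclosed : IsClosed (G : Set (E →L[ℝ] E)ˣ))
    (hGconn : IsConnected (G : Set (E →L[ℝ] E)ˣ))
    (hGC : ∀ g ∈ G, ((g : E →L[ℝ] E)) '' C = C)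
    (hGtrans : ∀ x ∈ interior C, ∀ y ∈ interior C,
      ∃ g ∈ G, (g : E →L[ℝ] E) x = y)
    (u : E) (hu : u ∈ interior C) :
    ∃ B : E →ₗ[ℝ] E →ₗ[ℝ] ℝ,
      (∀ x y : E, B x y = B y x) ∧ (∀ x : E, x ≠ 0 → 0 < B x x) ∧
      C = {y : E | ∀ x ∈ C, 0 ≤ B x y} ∧
      ∀ g ∈ G, ((g : E →L[ℝ] E) u = u ↔
        ∀ x y : E, B ((g : E →L[ℝ] E) x) ((g : E →L[ℝ] E) y) = B x y) := by
  obtain ⟨B₀, hs, hpos, hself⟩ := hsd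
  obtain ⟨T, hT⟩ := SDC.exists_iso B₀ hs hpos
  have hselfm : ∀ y, y ∈ C ↔ ∀ x ∈ C, 0 ≤ B₀ x y := fun y =>
    ⟨fun h => by rw [hself] at h; exact h, fun h => by rw [hself]; exact h⟩
  let Tc := T.toContinuousLinearEquiv
  have hmem : ∀ x, T x ∈ T '' C ↔ x ∈ C := fun x => T.injective.mem_set_image
  have hSD : SDC.SD (T '' C) := by
    intro y
    obtain ⟨y, rfl⟩ := T.surjective y
    rw [hmem, hselfm]
    simp [hT]
  have hintT : interior (T '' C) = T '' interior C := (Tc.toHomeomorph.image_interior C).symm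
  obtain ⟨e', he', hcore⟩ := SDC.core hSD (by
      rintro _ ⟨x, hx, rfl⟩ hn
      rw [← map_neg, hmem] at hn
      have : x ∈ C ∩ -C := ⟨hx, by simpa using hn⟩
      rw [hpointed] at this
      rw [show x = 0 from this, map_zero]) (by rw [hintT]; exact hint.image _)
  rw [hintT] at he'
  obtain ⟨e, he, rfl⟩ := he'
  obtain ⟨a, haG, hau⟩ := hGtrans e he u hu
  have hm1 : ∀ (g : (E →L[ℝ] E)ˣ) (x : E), ((g⁻¹ : (E →L[ℝ] E)ˣ) : E →L[ℝ] E) ((g : E →L[ℝ] E) x) = x := by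
    intro g x
    rw [← mul_apply_eq_comp, Units.inv_mul]; rfl
  have hm2 : ∀ (g : (E →L[ℝ] E)ˣ) (x : E), (g : E →L[ℝ] E) (((g⁻¹ : (E →L[ℝ] E)ˣ) : E →L[ℝ] E) x) = x := by
    intro g x
    rw [← mul_apply_eq_comp, Units.mul_inv]; rfl
  have hfwd : ∀ g ∈ G, ∀ x ∈ C, (g : E →L[ℝ] E) x ∈ C := fun g hg x hx => by
    have := Set.mem_image_of_mem (g : E →L[ℝ] E) hx
    rwa [hGC g hg] at this
  have hpres : ∀ g ∈ G, ∀ x, (g : E →L[ℝ] E) x ∈ C ↔ x ∈ C := fun g hg x =>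
    ⟨fun h => by simpa only [hm1] using hfwd _ (G.inv_mem hg) _ h, hfwd g hg x⟩
  set b : E →L[ℝ] E := ((a⁻¹ : (E →L[ℝ] E)ˣ) : E →L[ℝ] E) with hb
  refine ⟨B₀.compl₁₂ (b : E →ₗ[ℝ] E) (b : E →ₗ[ℝ] E), ?_, ?_, ?_, ?_⟩
  · intro x y
    simp only [LinearMap.compl₁₂_apply]
    exact hs _ _
  · intro x hx
    simp only [LinearMap.compl₁₂_apply]
    apply hpos
    intro h0
    apply hx
    have := hm2 a x
    rw [← this]
    erw [h0]; simp
  · ext y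
    simp only [LinearMap.compl₁₂_apply, Set.mem_ofPred_eq, ContinuousLinearMap.coe_coe]
    rw [← hpres a⁻¹ (G.inv_mem haG) y, hselfm]
    constructor
    · intro h x hx
      exact h _ (hfwd _ (G.inv_mem haG) x hx)
    · intro h x hx
      have := h _ (hfwd a haG x hx)
      rwa [hb, hm1] at this
  · intro g hg
    have hkG : a⁻¹ * g * a ∈ G := G.mul_mem (G.mul_mem (G.inv_mem haG) hg) haG
    let k : E ≃ₗ[ℝ] E := (ContinuousLinearEquiv.ofUnit (a⁻¹ * g * a)).toLinearEquiv
    have hk : ∀ x, k x = b ((g : E →L[ℝ] E) ((a : E →L[ℝ] E) x)) := fun x => rfl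
    have hkC : SDC.Pres (T '' C) (T.symm.trans (k.trans T)) := by
      intro x
      obtain ⟨x, rfl⟩ := T.surjective x
      simp only [LinearEquiv.trans_apply, LinearEquiv.symm_apply_apply]
      rw [hmem, hmem]
      exact hpres _ hkG x
    have key := hcore _ hkC
    simp only [LinearEquiv.trans_apply, LinearEquiv.symm_apply_apply, EmbeddingLike.apply_eq_iff_eq]
      at key
    have h1 : (g : E →L[ℝ] E) u = u ↔ k e = e := by
      rw [hk, hau]
      constructor
      · intro h
        rw [h, ← hau, hb, hm1]
      · intro h
        have := congrArg (a : E →L[ℝ] E) h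
        rwa [hb, hm2, hau] at this
    rw [h1, key]
    simp only [LinearMap.compl₁₂_apply, ContinuousLinearMap.coe_coe]
    constructor
    · intro h x y
      have := h (T (b x)) (T (b y))
      simp only [LinearEquiv.symm_apply_apply, ← hT, hk] at this
      rwa [hb, hm2, hm2] at this
    · intro h x y
      obtain ⟨x, rfl⟩ := T.surjective x
      obtain ⟨y, rfl⟩ := T.surjective y
      simp only [LinearEquiv.symm_apply_apply, ← hT, hk]
      rw [h, hb, hm1, hm1]
end
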